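/- arXiv:1101.4305 — 2 statements merged into one kernel-verified Lean document; each statement's English description precedes it below -/
import Mathlib

section
/- If x and y are elements of the first Weyl algebra A₁ over a field K of characteristic zero such that [y,x] = 1, then the centralizer of x in A₁ is the polynomial subalgebra generated by x, i.e. C(x) = K[x]. -/
def weylRel (K : Type*) [CommRing K] :
    FreeAlgebra K (Fin 2) → FreeAlgebra K (Fin 2) → Prop :=
  fun a b => a = FreeAlgebra.ι K 1 * FreeAlgebra.ι K 0 ∧
    b = FreeAlgebra.ι K 0 * FreeAlgebra.ι K 1 + 1

/-- The first Weyl algebra `A₁ = K⟨X, Y | YX - XY = 1⟩` over `K`,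
realized as the quotient of the free algebra on two generators `X, Y`
by the relation `Y * X = X * Y + 1`. -/
abbrev WeylAlgebra (K : Type*) [CommRing K] := RingQuot (weylRel K)

namespace WeylAux
open Polynomial

noncomputable def Dc (K : Type*) [Field K] : K[X][X] →ₗ[K] K[X][X] where
  toFun p := ∑ i ∈ p.support, monomial i (derivative (p.coeff i))
  map_add' p q := by
    ext1 n
    have hs : ∀ p : K[X][X], (∑ i ∈ p.support, monomial i (derivative (p.coeff i))).coeff n
        = derivative (p.coeff n) := by
      intro p
      simp only [finsetSum_coeff, coeff_monomial, Finset.sum_ite_eq', mem_support_iff]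
      split_ifs <;> simp_all
    rw [coeff_add, hs, hs, hs, coeff_add, derivative_add]
  map_smul' r p := by
    ext1 n
    simp only [finsetSum_coeff, coeff_monomial, coeff_smul, Finset.sum_ite_eq', mem_support_iff,
      RingHom.id_apply]
    split_ifs <;> simp_all

variable {K : Type*} [Field K]

theorem Dc_coeff (p : K[X][X]) (n : ℕ) : (Dc K p).coeff n = derivative (p.coeff n) := by
  simp only [Dc, LinearMap.coe_mk, AddHom.coe_mk, finsetSum_coeff, coeff_monomial,
    Finset.sum_ite_eq', mem_support_iff]
  split_ifs <;> simp_all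

theorem Dc_mul (p q : K[X][X]) : Dc K (p * q) = Dc K p * q + p * Dc K q := by
  ext1 n
  simp only [Dc_coeff, coeff_add, coeff_mul, derivative_sum, derivative_mul,
    Finset.sum_add_distrib]

theorem Dc_X : Dc K (X : K[X][X]) = 0 := by
  ext1 n
  rw [Dc_coeff, coeff_X]; split_ifs <;> simp

theorem Dc_C (f : K[X]) : Dc K (C f) = C (derivative f) := by
  ext1 n
  rw [Dc_coeff, coeff_C, coeff_C]; split_ifs <;> simp

theorem Dc_iter_natDegree (k : ℕ) (p : K[X][X]) : ((Dc K)^[k] p).natDegree ≤ p.natDegree := by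
  induction k with
  | zero => simp
  | succ k ih =>
    rw [Function.iterate_succ_apply']
    refine le_trans ?_ ih
    rw [natDegree_le_iff_coeff_eq_zero]
    intro N hN
    rw [Dc_coeff, coeff_eq_zero_of_natDegree_lt hN, derivative_zero]

theorem hasse_Dc (k : ℕ) (p : K[X][X]) : hasseDeriv k (Dc K p) = Dc K (hasseDeriv k p) := by
  ext1 n
  simp [hasseDeriv_coeff, Dc_coeff]

theorem hasse_X_mul (k : ℕ) (p : K[X][X]) :
    hasseDeriv (k+1) (X * p) = X * hasseDeriv (k+1) p + hasseDeriv k p := by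
  ext1 n
  cases n with
  | zero =>
    rw [coeff_add, coeff_X_mul_zero, hasseDeriv_coeff, hasseDeriv_coeff, zero_add, zero_add,
      coeff_X_mul]
    simp
  | succ n =>
    rw [coeff_add, coeff_X_mul, hasseDeriv_coeff, hasseDeriv_coeff, hasseDeriv_coeff,
      show n + 1 + (k + 1) = (n + 1 + k) + 1 by ring, coeff_X_mul,
      show n + (k + 1) = n + 1 + k by ring, Nat.choose_succ_succ]
    push_cast
    ring

/-- the regular representation -/
noncomputable def Yop (K : Type*) [Field K] : Module.End K K[X][X] :=
  LinearMap.mulLeft K (X : K[X][X]) + Dc K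
noncomputable def Xop (K : Type*) [Field K] : Module.End K K[X][X] :=
  LinearMap.mulLeft K (C X : K[X][X])

theorem Yop_apply (p : K[X][X]) : Yop K p = X * p + Dc K p := rfl
theorem Xop_apply (p : K[X][X]) : Xop K p = C X * p := rfl

noncomputable def rep (K : Type*) [Field K] : WeylAlgebra K →ₐ[K] Module.End K K[X][X] :=
  RingQuot.liftAlgHom K ⟨FreeAlgebra.lift K ![Xop K, Yop K], by
    rintro a b ⟨rfl, rfl⟩
    simp only [map_mul, map_add, map_one, FreeAlgebra.lift_ι_apply]
    ext1 p
    simp [Yop_apply, Xop_apply, Dc_mul, Dc_C]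
    ring⟩

noncomputable def gX (K : Type*) [Field K] : WeylAlgebra K :=
  RingQuot.mkAlgHom K (weylRel K) (FreeAlgebra.ι K 0)
noncomputable def gY (K : Type*) [Field K] : WeylAlgebra K :=
  RingQuot.mkAlgHom K (weylRel K) (FreeAlgebra.ι K 1)

theorem rep_gX : rep K (gX K) = Xop K := by
  simp [rep, gX]
theorem rep_gY : rep K (gY K) = Yop K := by
  simp [rep, gY]

theorem gY_gX : gY K * gX K = gX K * gY K + 1 := by
  have := RingQuot.mkAlgHom_rel K (s := weylRel K)
    (x := FreeAlgebra.ι K 1 * FreeAlgebra.ι K 0) (y := FreeAlgebra.ι K 0 * FreeAlgebra.ι K 1 + 1)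
    ⟨rfl, rfl⟩
  simpa [gX, gY] using this

theorem ind {P : WeylAlgebra K → Prop} (h1 : P 1) (hadd : ∀ a b, P a → P b → P (a + b))
    (hsmul : ∀ (r : K) a, P a → P (r • a))
    (hX : ∀ a, P a → P (gX K * a)) (hY : ∀ a, P a → P (gY K * a)) (a : WeylAlgebra K) : P a := by
  obtain ⟨a, rfl⟩ := RingQuot.mkAlgHom_surjective K (weylRel K) a
  suffices h : ∀ b, P b → P (RingQuot.mkAlgHom K (weylRel K) a * b) by simpa using h 1 h1
  induction a with
  | grade0 r => intro b hb; simpa [Algebra.smul_def] using hsmul r b hb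
  | grade1 i => fin_cases i; exacts [hX, hY]
  | mul a b ha hb => intro c hc; rw [map_mul, mul_assoc]; exact ha _ (hb _ hc)
  | add a b ha hb => intro c hc; rw [map_add, add_mul]; exact hadd _ _ (ha _ hc) (hb _ hc)

noncomputable def sg (K : Type*) [Field K] : WeylAlgebra K →ₗ[K] K[X][X] where
  toFun a := rep K a 1
  map_add' a b := by simp
  map_smul' r a := by simp

theorem sg_apply (a : WeylAlgebra K) : sg K a = rep K a 1 := rfl
theorem sg_mul' (a b : WeylAlgebra K) : sg K (a * b) = rep K a (sg K b) := by
  simp [sg_apply]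
theorem sg_one : sg K 1 = 1 := by simp [sg_apply]

theorem rep_formula (a : WeylAlgebra K) : ∃ N₀, ∀ N ≥ N₀, ∀ p, rep K a p =
    ∑ k ∈ Finset.range N, hasseDeriv k (sg K a) * (Dc K)^[k] p := by
  induction a using ind with
  | h1 =>
    refine ⟨1, fun N hN p => ?_⟩
    obtain ⟨N, rfl⟩ := Nat.exists_eq_add_of_le' hN
    rw [Finset.sum_range_succ', Finset.sum_eq_zero]
    · simp [sg_one]
    · intro k _
      rw [sg_one, hasseDeriv_apply_one _ (by omega), zero_mul]
  | hadd a b ha hb =>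
    obtain ⟨N₁, h₁⟩ := ha
    obtain ⟨N₂, h₂⟩ := hb
    refine ⟨max N₁ N₂, fun N hN p => ?_⟩
    rw [map_add, LinearMap.add_apply, h₁ N (by omega), h₂ N (by omega), ← Finset.sum_add_distrib]
    simp [add_mul]
  | hsmul r a ha =>
    obtain ⟨N₁, h₁⟩ := ha
    refine ⟨N₁, fun N hN p => ?_⟩
    rw [map_smul, LinearMap.smul_apply, h₁ N (by omega), Finset.smul_sum]
    refine Finset.sum_congr rfl fun k _ => ?_
    have : hasseDeriv k (r • sg K a) = r • hasseDeriv k (sg K a) := by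
      ext1 n; simp [hasseDeriv_coeff]
    rw [map_smul, this, smul_mul_assoc]
  | hX a ha =>
    obtain ⟨N₁, h₁⟩ := ha
    refine ⟨N₁, fun N hN p => ?_⟩
    rw [map_mul, sg_mul', rep_gX, Module.End.mul_apply, h₁ N hN, Xop_apply, Xop_apply,
      Finset.mul_sum]
    refine Finset.sum_congr rfl fun k _ => ?_
    rw [← smul_eq_C_mul, ← smul_eq_C_mul, map_smul, smul_mul_assoc]
  | hY a ha =>
    obtain ⟨N₁, h₁⟩ := ha
    refine ⟨max N₁ ((sg K a).natDegree + 1) + 1, fun N hN p => ?_⟩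
    obtain ⟨N, rfl⟩ := Nat.exists_eq_add_of_le' (show 1 ≤ N by omega)
    rw [map_mul, sg_mul', rep_gY, Module.End.mul_apply, Yop_apply, Yop_apply]
    nth_rewrite 1 [h₁ (N + 1) (by omega)]
    rw [h₁ N (by omega) p]
    simp only [map_add, map_sum, Dc_mul, add_mul, Finset.sum_add_distrib, ← hasse_Dc,
      ← Function.iterate_succ_apply' (Dc K)]
    have e : ∑ k ∈ Finset.range N, hasseDeriv k (Dc K (sg K a)) * (Dc K)^[k] p =
      ∑ k ∈ Finset.range (N+1), hasseDeriv k (Dc K (sg K a)) * (Dc K)^[k] p := by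
      rw [Finset.sum_range_succ, hasse_Dc N, hasseDeriv_eq_zero_of_lt_natDegree _ _ (by omega)]
      simp
    rw [e, ← add_assoc, ← add_right_comm, add_left_inj, 
      Finset.sum_range_succ' (fun k => hasseDeriv k (X * _) * _)]
    simp only [hasse_X_mul, add_mul, Finset.sum_add_distrib]
    rw [Finset.mul_sum, Finset.sum_range_succ']
    simp [mul_assoc]
    ring

noncomputable def tau (p : K[X][X]) : WeylAlgebra K :=
  eval₂ (aeval (gX K) : K[X] →ₐ[K] WeylAlgebra K).toRingHom (gY K) p

theorem tau_add (p q : K[X][X]) : tau (p + q) = tau p + tau q := eval₂_add _ _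

theorem tau_monomial (n : ℕ) (f : K[X]) : tau (monomial n f) = aeval (gX K) f * gY K ^ n := by
  simp [tau, eval₂_monomial]

theorem tau_smul (r : K) (p : K[X][X]) : tau (r • p) = r • tau p := by
  induction p using Polynomial.induction_on' with
  | add p q hp hq => rw [smul_add, tau_add, hp, hq, tau_add, smul_add]
  | monomial n f => rw [smul_monomial, tau_monomial, tau_monomial, map_smul, smul_mul_assoc]

theorem tau_X (p : K[X][X]) : tau (Xop K p) = gX K * tau p := by
  induction p using Polynomial.induction_on' with
  | add p q hp hq => rw [map_add, tau_add, hp, hq, tau_add, mul_add]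
  | monomial n f => rw [Xop_apply, C_mul_monomial, tau_monomial, tau_monomial, map_mul, aeval_X,
      mul_assoc]

theorem gY_aeval (f : K[X]) : gY K * aeval (gX K) f =
    aeval (gX K) f * gY K + aeval (gX K) (derivative f) := by
  induction f using Polynomial.induction_on with
  | C a => simp [Algebra.commutes]
  | add p q hp hq => simp only [map_add, mul_add, add_mul, hp, hq]; abel
  | monomial n a h =>
    rw [pow_succ, ← mul_assoc]
    generalize C a * X ^ n = f at h
    rw [map_mul, ← mul_assoc, h, aeval_X, add_mul, derivative_mul,
      map_add, map_mul, map_mul, aeval_X, derivative_X, map_one, mul_assoc _ (gY K), gY_gX]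
    noncomm_ring

theorem tau_Y (p : K[X][X]) : tau (Yop K p) = gY K * tau p := by
  induction p using Polynomial.induction_on' with
  | add p q hp hq => rw [map_add, tau_add, hp, hq, tau_add, mul_add]
  | monomial n f =>
    have : Dc K (monomial n f) = monomial n (derivative f) := by
      ext1 m
      rw [Dc_coeff, coeff_monomial, coeff_monomial]; split_ifs <;> simp
    rw [Yop_apply, tau_add, this, X_mul_monomial, tau_monomial, tau_monomial, tau_monomial,
      ← mul_assoc, gY_aeval, pow_succ', add_mul, mul_assoc]

theorem tau_sg (a : WeylAlgebra K) : tau (sg K a) = a := by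
  induction a using ind with
  | h1 =>
    rw [sg_one, ← C_1, ← monomial_zero_left, tau_monomial]; simp
  | hadd a b ha hb => rw [map_add, tau_add, ha, hb]
  | hsmul r a ha => rw [map_smul, tau_smul, ha]
  | hX a ha => rw [sg_mul', rep_gX, tau_X, ha]
  | hY a ha => rw [sg_mul', rep_gY, tau_Y, ha]

theorem sg_inj {a b : WeylAlgebra K} (h : sg K a = sg K b) : a = b := by
  rw [← tau_sg a, h, tau_sg]

theorem sg_ne {a : WeylAlgebra K} (h : a ≠ 0) : sg K a ≠ 0 := fun h' =>
  h (sg_inj (by rw [h', map_zero]))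

theorem sg_algebraMap (r : K) : sg K (algebraMap K _ r) = C (C r) := by
  rw [Algebra.algebraMap_eq_smul_one, map_smul, sg_one]
  ext1 n
  simp [coeff_one, coeff_C]
  split_ifs <;> simp [smul_eq_C_mul]

/-- product with remainder -/
theorem sg_mul (a b : WeylAlgebra K) : ∃ R : K[X][X],
    sg K (a * b) = sg K a * sg K b + derivative (sg K a) * Dc K (sg K b) + R ∧
    (∀ j, (sg K a).natDegree + (sg K b).natDegree ≤ j + 1 → R.coeff j = 0) := by
  obtain ⟨N, hN⟩ := rep_formula a
  refine ⟨∑ k ∈ Finset.range N, hasseDeriv (k+2) (sg K a) * (Dc K)^[k+2] (sg K b), ?_, ?_⟩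
  · rw [sg_mul', hN (N+2) (by omega), Finset.sum_range_succ', Finset.sum_range_succ']
    simp
    ring
  · intro j hj
    rw [finsetSum_coeff]
    refine Finset.sum_eq_zero fun k _ => ?_
    by_cases hk : (sg K a).natDegree < k + 2
    · rw [hasseDeriv_eq_zero_of_lt_natDegree _ _ hk]; simp
    · apply coeff_eq_zero_of_natDegree_lt
      refine lt_of_le_of_lt natDegree_mul_le ?_
      have h1 := natDegree_hasseDeriv_le (sg K a) (k+2)
      have h2 := Dc_iter_natDegree (k+2) (sg K b)
      omega

/-- `a` has Y-degree at most `N` and `N`-th coefficient `v` -/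
def HT (a : WeylAlgebra K) (N : ℕ) (v : K[X]) : Prop :=
  (sg K a).natDegree ≤ N ∧ (sg K a).coeff N = v

theorem HT.self (a : WeylAlgebra K) : HT a (sg K a).natDegree (sg K a).leadingCoeff :=
  ⟨le_rfl, rfl⟩

theorem Dc_natDegree (p : K[X][X]) : (Dc K p).natDegree ≤ p.natDegree := Dc_iter_natDegree 1 p

theorem HT.mul {a b : WeylAlgebra K} {N M : ℕ} {v w : K[X]} (ha : HT a N v) (hb : HT b M w) :
    HT (a * b) (N + M) (v * w) := by
  obtain ⟨R, hR, hR0⟩ := sg_mul a b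
  have key : ∀ j, N + M ≤ j → (derivative (sg K a) * Dc K (sg K b)).coeff j = 0 := by
    intro j hj
    by_cases h0 : (sg K a).natDegree = 0
    · rw [eq_C_of_natDegree_eq_zero h0]; simp
    · apply coeff_eq_zero_of_natDegree_lt
      refine lt_of_le_of_lt natDegree_mul_le ?_
      have h1 := natDegree_derivative_le (sg K a)
      have h2 := Dc_natDegree (sg K b)
      have := ha.1
      have := hb.1
      omega
  have key2 : ∀ j, N + M ≤ j → (sg K (a * b)).coeff j = (sg K a * sg K b).coeff j := by
    intro j hj
    have := ha.1
    have := hb.1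
    rw [hR, coeff_add, coeff_add, key j hj, hR0 j (by omega), add_zero, add_zero]
  constructor
  · rw [natDegree_le_iff_coeff_eq_zero]
    intro j hj
    rw [key2 j hj.le]
    apply coeff_eq_zero_of_natDegree_lt
    refine lt_of_le_of_lt natDegree_mul_le ?_
    have := ha.1
    have := hb.1
    omega
  · rw [key2 _ le_rfl, coeff_mul_add_eq_of_natDegree_le ha.1 hb.1, ha.2, hb.2]

theorem HT.add {a b : WeylAlgebra K} {N : ℕ} {v w : K[X]} (ha : HT a N v) (hb : HT b N w) :
    HT (a + b) N (v + w) := by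
  constructor
  · rw [map_add]; exact (natDegree_add_le_of_degree_le ha.1 hb.1)
  · rw [map_add, coeff_add, ha.2, hb.2]

theorem HT.smul {a : WeylAlgebra K} {N : ℕ} {v : K[X]} (r : K) (ha : HT a N v) :
    HT (r • a) N (r • v) := by
  constructor
  · rw [map_smul]; exact (natDegree_smul_le _ _).trans ha.1
  · rw [map_smul, coeff_smul, ha.2]

theorem HT.sub {a b : WeylAlgebra K} {N : ℕ} {v w : K[X]} (ha : HT a N v) (hb : HT b N w) :
    HT (a - b) N (v - w) := by
  constructor
  · rw [map_sub]; exact (natDegree_sub_le_of_le ha.1 hb.1).trans (max_self N).le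
  · rw [map_sub, coeff_sub, ha.2, hb.2]

theorem HT.one : HT (1 : WeylAlgebra K) 0 1 := by simp [HT, sg_one]

theorem HT.pow {a : WeylAlgebra K} {N : ℕ} {v : K[X]} (ha : HT a N v) (k : ℕ) :
    HT (a ^ k) (k * N) (v ^ k) := by
  induction k with
  | zero => simpa using HT.one
  | succ k ih => rw [pow_succ, pow_succ, add_mul, one_mul]; exact ih.mul ha

theorem HT.natDegree {a : WeylAlgebra K} {N : ℕ} {v : K[X]} (ha : HT a N v) (hv : v ≠ 0) :
    (sg K a).natDegree = N :=
  le_antisymm ha.1 (le_natDegree_of_ne_zero (by rw [ha.2]; exact hv))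

/-- commutator coefficient -/
theorem comm_coeff (a b : WeylAlgebra K) (j : ℕ)
    (hj : j + 1 = (sg K a).natDegree + (sg K b).natDegree) :
    (sg K (a * b - b * a)).coeff j =
      (sg K a).natDegree * (sg K a).leadingCoeff * derivative (sg K b).leadingCoeff
      - (sg K b).natDegree * (sg K b).leadingCoeff * derivative (sg K a).leadingCoeff := by
  have key : ∀ a b : WeylAlgebra K, j + 1 = (sg K a).natDegree + (sg K b).natDegree →
      (derivative (sg K a) * Dc K (sg K b)).coeff j =
      (sg K a).natDegree * (sg K a).leadingCoeff * derivative (sg K b).leadingCoeff := by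
    intro a b hj
    by_cases h0 : (sg K a).natDegree = 0
    · rw [h0, eq_C_of_natDegree_eq_zero h0]; simp
    · obtain ⟨n, hn⟩ := Nat.exists_eq_succ_of_ne_zero h0
      have h1 := natDegree_derivative_le (sg K a)
      have : j = n + (sg K b).natDegree := by omega
      rw [this, coeff_mul_add_eq_of_natDegree_le (by omega) (Dc_natDegree _), Dc_coeff,
        coeff_derivative, leadingCoeff, leadingCoeff, hn]
      push_cast
      ring
  obtain ⟨R, hR, hR0⟩ := sg_mul a b
  obtain ⟨S, hS, hS0⟩ := sg_mul b a
  rw [map_sub, hR, hS, coeff_sub, coeff_add, coeff_add, coeff_add, coeff_add,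
    hR0 j (by omega), hS0 j (by omega), key a b hj, key b a (by omega), mul_comm (sg K b)]
  ring

theorem comm_lc {a b : WeylAlgebra K} (h : a * b = b * a) :
      (sg K a).natDegree * (sg K a).leadingCoeff * derivative (sg K b).leadingCoeff
      = (sg K b).natDegree * (sg K b).leadingCoeff * derivative (sg K a).leadingCoeff := by
  by_cases h0 : (sg K a).natDegree + (sg K b).natDegree = 0
  · have h1 : (sg K a).natDegree = 0 := by omega
    have h2 : (sg K b).natDegree = 0 := by omega
    rw [h1, h2]; simp
  · have := comm_coeff a b ((sg K a).natDegree + (sg K b).natDegree - 1) (by omega)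
    rw [h, sub_self, map_zero, coeff_zero] at this
    exact (sub_eq_zero.mp this.symm)

section main
set_option linter.unusedSectionVars false
variable [CharZero K]

theorem natDegree_eq_of_wr {f g : K[X]} (hf : f ≠ 0) (hg : g ≠ 0)
    (h : derivative f * g = f * derivative g) : f.natDegree = g.natDegree := by
  have e : ∀ p : K[X], (X * derivative p).natDegree ≤ p.natDegree ∧
      (X * derivative p).coeff p.natDegree = p.natDegree * p.leadingCoeff := by
    intro p
    have e1 : ∀ j, (X * derivative p).coeff j = j * p.coeff j := by
      intro j
      cases j with
      | zero => simp
      | succ j => rw [coeff_X_mul, coeff_derivative]; push_cast; ring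
    refine ⟨?_, e1 _⟩
    rw [natDegree_le_iff_coeff_eq_zero]
    intro j hj
    rw [e1, coeff_eq_zero_of_natDegree_lt hj, mul_zero]
  have h2 : (X * derivative f) * g = f * (X * derivative g) := by linear_combination X * h
  have h3 := congrArg (fun p => p.coeff (f.natDegree + g.natDegree)) h2
  rw [coeff_mul_add_eq_of_natDegree_le (e f).1 le_rfl,
    coeff_mul_add_eq_of_natDegree_le le_rfl (e g).1, (e f).2, (e g).2] at h3
  have hf' := leadingCoeff_ne_zero.mpr hf
  have hg' := leadingCoeff_ne_zero.mpr hg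
  have h4 : ((f.natDegree : K) - g.natDegree) * (f.leadingCoeff * g.leadingCoeff) = 0 := by
    simp only [leadingCoeff] at *
    linear_combination h3
  rcases mul_eq_zero.mp h4 with h5 | h5
  · exact_mod_cast sub_eq_zero.mp h5
  · exact absurd h5 (mul_ne_zero hf' hg')

theorem prop_of_wr {f g : K[X]} (hg : g ≠ 0)
    (h : derivative f * g = f * derivative g) : ∃ r : K, f = r • g := by
  by_cases hf : f = 0
  · exact ⟨0, by simp [hf]⟩
  refine ⟨f.leadingCoeff / g.leadingCoeff, ?_⟩
  set r := f.leadingCoeff / g.leadingCoeff with hr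
  by_contra hne
  have h0 : f - r • g ≠ 0 := sub_ne_zero.mpr hne
  have hd := natDegree_eq_of_wr hf hg h
  have hw : derivative (f - r • g) * g = (f - r • g) * derivative g := by
    simp only [derivative_sub, smul_eq_C_mul, derivative_C_mul]
    linear_combination h
  have hd2 := natDegree_eq_of_wr h0 hg hw
  have : (f - r • g).coeff (f - r • g).natDegree = 0 := by
    rw [coeff_sub, coeff_smul, hd2, hr]
    conv_lhs => rw [← hd]
    rw [coeff_natDegree, hd, coeff_natDegree, smul_eq_mul,
      div_mul_cancel₀ _ (leadingCoeff_ne_zero.mpr hg), sub_self]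
  exact h0 (leadingCoeff_eq_zero.mp this)

variable {x y : WeylAlgebra K}

theorem exists_sub {b c : WeylAlgebra K} (hx : 0 < (sg K x).natDegree)
    (hb : b * x = x * b) (hc : c * x = x * c)
    (hc0 : c ≠ 0) (hd : (sg K b).natDegree = (sg K c).natDegree) :
    ∃ r : K, HT (b - r • c) (sg K b).natDegree 0 ∧
      (sg K b).leadingCoeff = r • (sg K c).leadingCoeff := by
  have h1 := comm_lc hb
  have h2 := comm_lc hc
  have hx0 : sg K x ≠ 0 := by rintro h; simp [h] at hx
  have hg := leadingCoeff_ne_zero.mpr (sg_ne hc0)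
  obtain ⟨r, hr⟩ := prop_of_wr (f := (sg K b).leadingCoeff) hg (by
    have h3 : ((sg K x).natDegree : K[X]) * (sg K x).leadingCoeff ≠ 0 :=
      mul_ne_zero (by exact_mod_cast hx.ne') (leadingCoeff_ne_zero.mpr hx0)
    apply mul_left_cancel₀ h3
    rw [hd] at h1
    linear_combination (sg K b).leadingCoeff * h2 - (sg K c).leadingCoeff * h1)
  refine ⟨r, ?_, hr⟩
  have := (HT.self b).sub ((HT.self c).smul r |> fun h => hd ▸ h)
  rwa [hr, sub_self] at this

theorem scalar_of_deg {b : WeylAlgebra K} (hx : 0 < (sg K x).natDegree)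
    (hb : b * x = x * b) (hd : (sg K b).natDegree = 0) : ∃ r, b = algebraMap K _ r := by
  have hx0 : sg K x ≠ 0 := by rintro h; simp [h] at hx
  have h3 : ((sg K x).natDegree : K[X]) * (sg K x).leadingCoeff ≠ 0 :=
      mul_ne_zero (by exact_mod_cast hx.ne') (leadingCoeff_ne_zero.mpr hx0)
  have h1 := comm_lc hb
  rw [hd, Nat.cast_zero, zero_mul, zero_mul] at h1
  have h4 := (mul_eq_zero.mp h1.symm).resolve_left h3
  refine ⟨(sg K b).leadingCoeff.coeff 0, sg_inj ?_⟩
  rw [sg_algebraMap, ← eq_C_of_derivative_eq_zero h4, leadingCoeff, hd]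
  exact eq_C_of_natDegree_eq_zero hd

/-- `ad y` -/
def ad (y b : WeylAlgebra K) : WeylAlgebra K := y * b - b * y

theorem ad_mul (y a b : WeylAlgebra K) : ad y (a * b) = ad y a * b + a * ad y b := by
  simp only [ad, sub_mul, mul_sub, mul_assoc]; abel
theorem ad_add (y a b : WeylAlgebra K) : ad y (a + b) = ad y a + ad y b := by
  simp only [ad]; noncomm_ring
theorem ad_sub (y a b : WeylAlgebra K) : ad y (a - b) = ad y a - ad y b := by
  simp only [ad, sub_mul, mul_sub]; abel
theorem ad_smul (y : WeylAlgebra K) (r : K) (b : WeylAlgebra K) :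
    ad y (r • b) = r • ad y b := by
  simp only [ad, mul_smul_comm, smul_mul_assoc, smul_sub]
theorem ad_algebraMap (y : WeylAlgebra K) (r : K) : ad y (algebraMap K _ r) = 0 := by
  rw [ad, Algebra.commutes, sub_self]

theorem ad_pow (hxy : ad y x = 1) (k : ℕ) : ad y (x ^ (k+1)) = ((k : K) + 1) • x ^ k := by
  induction k with
  | zero => simp [hxy]
  | succ k ih =>
    rw [pow_succ, ad_mul, ih, hxy, smul_mul_assoc, ← pow_succ, mul_one, Nat.cast_succ,
      add_smul ((k : K) + 1) (1 : K), one_smul]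

theorem ad_comm (hxy : ad y x = 1) {b : WeylAlgebra K} (hb : b * x = x * b) :
    ad y b * x = x * ad y b := by
  have h := congrArg (ad y) hb
  rw [ad_mul, ad_mul, hxy, mul_one, one_mul, add_comm] at h
  exact add_left_cancel h

theorem HT_ad_pow (b : WeylAlgebra K) {s t : ℕ} {v w : K[X]} (hb : HT b s v)
    (hd : HT (ad y b) t w) (k : ℕ) : HT (ad y (b ^ (k+1))) (k * s + t) ((k + 1) * v ^ k * w) := by
  induction k with
  | zero => simpa using hd
  | succ k ih =>
    rw [pow_succ, ad_mul]
    have h1 := ih.mul hb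
    have h2 := (hb.pow (k+1)).mul hd
    have e1 : k * s + t + s = (k + 1) * s + t := by ring
    rw [e1] at h1
    have h3 := h1.add h2
    have e2 : (k + 1) * v ^ k * w * v + v ^ (k + 1) * w = ((k + 1 : ℕ) + 1) * v ^ (k+1) * w := by
      push_cast; ring
    rwa [e2] at h3

/-- `b ^ n` is a multiple of `x ^ s` modulo lower order -/
theorem pow_sub (hx : 0 < (sg K x).natDegree) {b : WeylAlgebra K}
    (hb : b * x = x * b) (hs : 0 < (sg K b).natDegree) :
    ∃ r : K, r ≠ 0 ∧ ∃ e : WeylAlgebra K, e * x = x * e ∧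
      b ^ (sg K x).natDegree = r • x ^ (sg K b).natDegree + e ∧
      (sg K e).natDegree < (sg K b).natDegree * (sg K x).natDegree := by
  set n := (sg K x).natDegree with hn
  set s := (sg K b).natDegree with hs'
  have hx0 : sg K x ≠ 0 := by rintro h; simp [hn, h] at hx
  have hb0 : sg K b ≠ 0 := by rintro h; simp [hs', h] at hs
  have hlb := pow_ne_zero n (leadingCoeff_ne_zero.mpr hb0)
  have hlx := pow_ne_zero s (leadingCoeff_ne_zero.mpr hx0)
  have h1 := (HT.self b).pow n
  have h2 := (HT.self x).pow s
  have d1 := h1.natDegree hlb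
  have d2 := h2.natDegree hlx
  rw [← hs'] at d1
  rw [← hn] at d2
  have c1 : b ^ n * x = x * b ^ n := (Commute.pow_left (show Commute b x from hb) n)
  have c2 : x ^ s * x = x * x ^ s := (Commute.pow_left (Commute.refl x) s)
  have hne : x ^ s ≠ 0 := by
    rintro h
    rw [h] at d2
    simp only [map_zero, natDegree_zero] at d2
    have := Nat.mul_pos hs hx
    omega
  obtain ⟨r, hr, hr'⟩ := exists_sub hx c1 c2 hne (by rw [d1, d2, mul_comm])
  refine ⟨r, ?_, b ^ n - r • x ^ s, ?_, by abel, ?_⟩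
  · rintro rfl
    rw [zero_smul, leadingCoeff_eq_zero] at hr'
    rw [hr', natDegree_zero] at d1
    have := Nat.mul_pos hx hs
    omega
  · rw [sub_mul, mul_sub, c1, smul_mul_assoc, c2, mul_smul_comm]
  · rw [d1] at hr
    have hpos := Nat.mul_pos hx hs
    have hle := hr.1
    rw [mul_comm s n]
    refine lt_of_le_of_ne hle fun h => ?_
    have h0 := hr.2
    rw [← h] at h0
    have h5 := leadingCoeff_eq_zero.mp h0
    rw [h5, natDegree_zero] at h
    omega

def Q (x y : WeylAlgebra K) (M : ℕ) : Prop := ∀ b, b * x = x * b → ∀ j,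
  (sg K (ad y b)).coeff j ≠ 0 → j + (sg K x).natDegree ≤ (sg K b).natDegree + M

theorem Q_big : Q x y ((sg K y).natDegree + (sg K x).natDegree) := by
  intro b hb j hj
  have h1 := (HT.self y).mul (HT.self b)
  have h2 := (HT.self b).mul (HT.self y)
  rw [add_comm] at h2
  have := (h1.sub h2).1
  have h3 := le_natDegree_of_ne_zero hj
  rw [ad] at h3
  omega

theorem Q_step (hxy : ad y x = 1) (hx : 0 < (sg K x).natDegree) (M : ℕ) (hQ : Q x y (M+1)) :
    Q x y M := by
  intro b hb j hj
  by_contra hlt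
  have hle := hQ b hb j hj
  have hs : 0 < (sg K b).natDegree := by
    by_contra h0
    obtain ⟨r, rfl⟩ := scalar_of_deg hx hb (by omega)
    rw [ad_algebraMap] at hj
    simp at hj
  have hjd : HT (ad y b) j ((sg K (ad y b)).coeff j) := by
    refine ⟨?_, rfl⟩
    rw [natDegree_le_iff_coeff_eq_zero]
    intro i hi
    by_contra hne
    have := hQ b hb i hne
    omega
  obtain ⟨r, hr, e, he, hbe, hde⟩ := pow_sub hx hb hs
  obtain ⟨n, hn⟩ : ∃ k, (sg K x).natDegree = k + 1 := Nat.exists_eq_add_of_le' hx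
  obtain ⟨s, hs'⟩ : ∃ k, (sg K b).natDegree = k + 1 := Nat.exists_eq_add_of_le' hs
  have h1 := HT_ad_pow b (HT.self b) hjd n
  have hb0 : sg K b ≠ 0 := by rintro h; simp [h] at hs
  have hne : ((n : K[X]) + 1) * (sg K b).leadingCoeff ^ n * (sg K (ad y b)).coeff j ≠ 0 :=
    mul_ne_zero (mul_ne_zero (by exact_mod_cast Nat.succ_ne_zero n)
      (pow_ne_zero _ (leadingCoeff_ne_zero.mpr hb0))) hj
  apply hne
  rw [← h1.2]
  rw [hn, hs'] at hbe hde
  rw [hn, hs'] at hle hlt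
  rw [hbe, ad_add, ad_smul, ad_pow hxy, map_add, coeff_add, hs']
  have hx2 := ((((HT.self x).pow s).smul ((s : K) + 1)).smul r).1
  rw [hn] at hx2
  rw [coeff_eq_zero_of_natDegree_lt (lt_of_le_of_lt hx2 (by nlinarith)), zero_add]
  by_contra hne2
  have := hQ e he _ hne2
  rw [hn] at this
  nlinarith

theorem Q_zero (hxy : ad y x = 1) (hx : 0 < (sg K x).natDegree) : Q x y 0 := by
  have : ∀ M, Q x y M → Q x y 0 := by
    intro M
    induction M with
    | zero => exact id
    | succ M ih => exact fun h => ih (Q_step hxy hx M h)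
  exact this _ Q_big

theorem scalar_of_ad (hxy : ad y x = 1) (hx : 0 < (sg K x).natDegree) {b : WeylAlgebra K}
    (hb : b * x = x * b) (h0 : ad y b = 0) : ∃ r, b = algebraMap K _ r := by
  rcases Nat.eq_zero_or_pos (sg K b).natDegree with hs | hs
  · exact scalar_of_deg hx hb hs
  exfalso
  obtain ⟨r, hr, e, he, hbe, hde⟩ := pow_sub hx hb hs
  have hx0 : sg K x ≠ 0 := by rintro h; simp [h] at hx
  obtain ⟨n, hn⟩ : ∃ k, (sg K x).natDegree = k + 1 := Nat.exists_eq_add_of_le' hx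
  obtain ⟨s, hs'⟩ : ∃ k, (sg K b).natDegree = k + 1 := Nat.exists_eq_add_of_le' hs
  have h1 : ad y (b ^ (n+1)) = 0 := by
    have : ∀ k, ad y (b ^ k) = 0 := by
      intro k
      induction k with
      | zero => simp [ad]
      | succ k ih => rw [pow_succ, ad_mul, ih, h0]; simp
    exact this _
  rw [hn, hs'] at hbe hde
  rw [hbe, ad_add, ad_smul, ad_pow hxy] at h1
  have h2 := (((HT.self x).pow s).smul ((s : K) + 1)).smul r
  have h3 : (sg K (ad y e)).coeff (s * (sg K x).natDegree) = 0 := by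
    by_contra hne
    have := Q_zero hxy hx e he _ hne
    rw [hn] at this
    nlinarith
  have h4 := congrArg (fun z => (sg K z).coeff (s * (sg K x).natDegree)) h1
  simp only [map_add, coeff_add, map_zero, coeff_zero, h3, add_zero] at h4
  rw [h2.2] at h4
  have hs1 : (s : K) + 1 ≠ 0 := by exact_mod_cast Nat.succ_ne_zero s
  exact smul_ne_zero hr (smul_ne_zero hs1 (pow_ne_zero s (leadingCoeff_ne_zero.mpr hx0))) h4

theorem exists_int (hxy : ad y x = 1) (p : K[X]) : ∃ q : K[X], ad y (aeval x q) = aeval x p := by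
  induction p using Polynomial.induction_on' with
  | add p q hp hq =>
    obtain ⟨a, ha⟩ := hp
    obtain ⟨b, hb⟩ := hq
    exact ⟨a + b, by rw [map_add, ad_add, ha, hb, map_add]⟩
  | monomial n a =>
    have hs1 : (n : K) + 1 ≠ 0 := by exact_mod_cast Nat.succ_ne_zero n
    refine ⟨monomial (n+1) (a / (n+1)), ?_⟩
    rw [aeval_monomial, aeval_monomial, ← Algebra.smul_def, ← Algebra.smul_def, ad_smul,
      ad_pow hxy, smul_smul, div_mul_cancel₀ _ hs1]

theorem main_pos (hxy : ad y x = 1) (hx : 0 < (sg K x).natDegree) :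
    ∀ (d : ℕ) (b : WeylAlgebra K), (sg K b).natDegree ≤ d → b * x = x * b →
      ∃ p : K[X], b = aeval x p := by
  intro d
  induction d with
  | zero =>
    intro b hd hb
    obtain ⟨r, rfl⟩ := scalar_of_deg hx hb (by omega)
    exact ⟨C r, by rw [aeval_C]⟩
  | succ d ih =>
    intro b hd hb
    have : ∃ p : K[X], ad y b = aeval x p := by
      refine ih _ ?_ (ad_comm hxy hb)
      rw [natDegree_le_iff_coeff_eq_zero]
      intro j hj
      by_contra hne
      have := Q_zero hxy hx b hb j hne
      omega
    obtain ⟨p, hp⟩ := this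
    obtain ⟨q, hq⟩ := exists_int hxy p
    have hc : aeval x q * x = x * aeval x q := by
      have h := mul_comm q X
      have := congrArg (aeval x) h
      simpa using this
    obtain ⟨r, hr⟩ := scalar_of_ad hxy hx (b := b - aeval x q)
      (by rw [sub_mul, mul_sub, hb, hc]) (by rw [ad_sub, hp, hq, sub_self])
    refine ⟨q + C r, ?_⟩
    rw [map_add, aeval_C, ← hr]
    abel

theorem main_zero (hxy : ad y x = 1) (hx : (sg K x).natDegree = 0) 
    (b : WeylAlgebra K) (hb : b * x = x * b) : ∃ p : K[X], b = aeval x p := by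
  set h := (sg K x).leadingCoeff with hh
  have hxC : sg K x = C h := by
    rw [hh, leadingCoeff, hx]; exact eq_C_of_natDegree_eq_zero hx
  have hh' : derivative h ≠ 0 := by
    intro h0
    have : x = algebraMap K _ (h.coeff 0) := by
      apply sg_inj
      rw [sg_algebraMap, ← eq_C_of_derivative_eq_zero h0, hxC]
    rw [this, ad_algebraMap] at hxy
    have := congrArg (sg K) hxy
    rw [map_zero, sg_one] at this
    exact zero_ne_one this
  -- degree-zero elements multiply as polynomials
  have hmul : ∀ (a b : WeylAlgebra K) (f g : K[X]), sg K a = C f → sg K b = C g →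
      sg K (a * b) = C (f * g) := by
    intro a b f g ha hb
    have h1 : HT a 0 f := ⟨by rw [ha]; simp, by rw [ha]; simp⟩
    have h2 : HT b 0 g := ⟨by rw [hb]; simp, by rw [hb]; simp⟩
    have h3 := h1.mul h2
    rw [← h3.2]
    exact eq_C_of_natDegree_le_zero h3.1
  have hdeg : h.natDegree = 1 := by
    have hy0 : (sg K y).natDegree ≠ 0 := by
      intro hy
      have hyC := eq_C_of_natDegree_eq_zero hy
      have h1 := congrArg (sg K) hxy
      rw [ad, map_sub, hmul _ _ _ _ hyC hxC, hmul _ _ _ _ hxC hyC, sg_one, mul_comm, sub_self] at h1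
      exact zero_ne_one h1
    have hyne : sg K y ≠ 0 := by rintro h; simp [h] at hy0
    have h1 := comm_coeff y x ((sg K y).natDegree - 1) (by omega)
    rw [show y * x - x * y = 1 from hxy, hx, Nat.cast_zero, zero_mul, zero_mul, sub_zero,
      sg_one, ← hh] at h1
    have hne : ((sg K y).natDegree : K[X]) * (sg K y).leadingCoeff * derivative h ≠ 0 :=
      mul_ne_zero (mul_ne_zero (by exact_mod_cast hy0) (leadingCoeff_ne_zero.mpr hyne)) hh'
    rw [coeff_one] at h1
    split_ifs at h1 with h2
    · have hu : IsUnit (derivative h) := IsUnit.of_mul_eq_one _ (by rw [mul_comm]; exact h1.symm)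
      have h3 := natDegree_eq_zero_of_isUnit hu
      have h4 : h.natDegree ≠ 0 := fun h5 => hh' (derivative_of_natDegree_zero h5)
      have h6 := natDegree_derivative (p := h)
      omega
    · exact absurd h1.symm hne
  have hb0 : (sg K b).natDegree = 0 := by
    by_contra hne
    have hbne : sg K b ≠ 0 := by rintro h; simp [h] at hne
    have h1 := comm_lc hb
    rw [hx, Nat.cast_zero, zero_mul, zero_mul, ← hh] at h1
    exact mul_ne_zero (mul_ne_zero (by exact_mod_cast hne) (leadingCoeff_ne_zero.mpr hbne)) hh' h1
  have hpoly : ∀ p : K[X], sg K (aeval x p) = C (p.comp h) := by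
    intro p
    induction p using Polynomial.induction_on with
    | C a => rw [aeval_C, sg_algebraMap, C_comp]
    | add p q hp hq => rw [map_add, map_add, hp, hq, add_comp, C_add]
    | monomial n a ih =>
      rw [pow_succ, ← mul_assoc, map_mul, aeval_X, hmul _ _ _ _ ih hxC,
        mul_comp _ X, X_comp]
  have hbC := eq_C_of_natDegree_eq_zero hb0
  set f := (sg K b).coeff 0
  obtain ⟨u, v, hu, huv⟩ : ∃ u v : K, u ≠ 0 ∧ h = C u * X + C v := by
    refine ⟨h.coeff 1, h.coeff 0, ?_, eq_X_add_C_of_natDegree_le_one hdeg.le⟩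
    rw [← hdeg]
    exact leadingCoeff_ne_zero.mpr (by rintro h0; simp [h0] at hdeg)
  refine ⟨f.comp (C u⁻¹ * (X - C v)), sg_inj ?_⟩
  rw [hpoly, hbC, comp_assoc]
  congr 1
  have : (C u⁻¹ * (X - C v)).comp h = X := by
    rw [mul_comp, sub_comp, C_comp, X_comp, C_comp, huv, add_sub_cancel_right, ← mul_assoc, ← C_mul,
      inv_mul_cancel₀ hu, C_1, one_mul]
  rw [this, comp_X]

end main
end WeylAux

/-- **Theorem 1.5 (Guccione–Guccione–Valqui).** If `[y,x] = 1` for elements `x, y` of the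
Weyl algebra `A₁` over a field `K` of characteristic zero, then the centralizer `C(x)` of
`x` in `A₁` equals the polynomial subalgebra `K[x]`. -/
theorem centralizer_x_eq_adjoin (K : Type*) [Field K] [CharZero K]
    (x y : WeylAlgebra K) (hxy : y * x - x * y = 1) :
    Subalgebra.centralizer K ({x} : Set (WeylAlgebra K)) =
      Algebra.adjoin K ({x} : Set (WeylAlgebra K)) := by
  apply le_antisymm
  · intro b hb
    have hb' : b * x = x * b := by
      have := (Subalgebra.mem_centralizer_iff K).mp hb x rfl
      exact this.symm
    have : ∃ p : Polynomial K, b = Polynomial.aeval x p := by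
      rcases Nat.eq_zero_or_pos (WeylAux.sg K x).natDegree with h | h
      · exact WeylAux.main_zero hxy h b hb'
      · exact WeylAux.main_pos hxy h _ b le_rfl hb'
    obtain ⟨p, rfl⟩ := this
    exact Polynomial.aeval_mem_adjoin_singleton K x
  · rw [Algebra.adjoin_le_iff]
    rintro z rfl
    show z ∈ Subalgebra.centralizer K {z}
    rw [Subalgebra.mem_centralizer_iff]
    rintro g rfl
    rfl
end

section
/- Suppose [y,x] = 1 for elements x, y of the first Weyl algebra A₁ over a field K of characteristic zero; let A₁' := K⟨x,y⟩ and δ := ad(x)∘ad(y). Then N(δ, A₁) := {a ∈ A₁ : δⁿ(a) = 0 for some n ≥ 1} equals A₁'; that is, the set of elements of A₁ annihilated by some power of the map δ is exactly the subalgebra generated by x and y. -/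
namespace WeylAux
open Polynomial

variable {K : Type*} [Field K] {A : Type*} [Ring A] [Algebra K A]

/-- The derivation `a ↦ [a, z]`. -/
noncomputable def D (K : Type*) [Field K] {A : Type*} [Ring A] [Algebra K A] (z : A) : A →ₗ[K] A :=
  LinearMap.mulRight K z - LinearMap.mulLeft K z

lemma D_apply (z a : A) : D K z a = a * z - z * a := rfl

lemma D_mul (z a b : A) : D K z (a * b) = D K z a * b + a * D K z b := by
  simp only [D_apply]; noncomm_ring

/-- Divided powers of `D`. -/
noncomputable def E (K : Type*) [Field K] {A : Type*} [Ring A] [Algebra K A] (z : A) (k : ℕ) :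
    A →ₗ[K] A := ((k.factorial : K)⁻¹) • (D K z) ^ k

lemma E_zero (z a : A) : E K z 0 a = a := by simp [E]

lemma D_E [CharZero K] (z : A) (k : ℕ) (a : A) :
    D K z (E K z k a) = ((k + 1 : ℕ) : K) • E K z (k + 1) a := by
  have h : ((k.factorial : ℕ) : K) ≠ 0 := by exact_mod_cast k.factorial_ne_zero
  have h' : ((k + 1 : ℕ) : K) ≠ 0 := by exact_mod_cast k.succ_ne_zero
  simp only [E, LinearMap.smul_apply, map_smul, smul_smul, pow_succ' (D K z) k, Module.End.mul_apply]
  congr 1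
  rw [Nat.factorial_succ]; push_cast at h' ⊢; field_simp

lemma E_succ [CharZero K] (z : A) (k : ℕ) (a : A) :
    E K z (k + 1) a = ((k + 1 : ℕ) : K)⁻¹ • D K z (E K z k a) := by
  have h' : ((k + 1 : ℕ) : K) ≠ 0 := by exact_mod_cast k.succ_ne_zero
  rw [D_E, smul_smul, inv_mul_cancel₀ h', one_smul]

lemma E_mul [CharZero K] (z : A) (k : ℕ) (a b : A) :
    E K z k (a * b) = ∑ p ∈ Finset.HasAntidiagonal.antidiagonal k, E K z p.1 a * E K z p.2 b := by
  induction k with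
  | zero => simp [E_zero]
  | succ k ih =>
    have h' : ((k + 1 : ℕ) : K) ≠ 0 := by exact_mod_cast k.succ_ne_zero
    rw [E_succ, ih, map_sum, inv_smul_eq_iff₀ h', Finset.smul_sum]
    have e1 : ∑ p ∈ Finset.HasAntidiagonal.antidiagonal (k+1), ((k + 1 : ℕ) : K) • (E K z p.1 a * E K z p.2 b)
      = ∑ p ∈ Finset.HasAntidiagonal.antidiagonal (k+1), ((p.1 : K) • (E K z p.1 a * E K z p.2 b)) +
        ∑ p ∈ Finset.HasAntidiagonal.antidiagonal (k+1), ((p.2 : K) • (E K z p.1 a * E K z p.2 b)) := by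
      rw [← Finset.sum_add_distrib]
      refine Finset.sum_congr rfl fun p hp => ?_
      rw [← add_smul, ← Finset.HasAntidiagonal.mem_antidiagonal.1 hp]; push_cast; rfl
    rw [e1, Finset.Nat.sum_antidiagonal_succ, Finset.Nat.sum_antidiagonal_succ']
    simp only [Nat.cast_zero, zero_smul, zero_add]
    rw [← Finset.sum_add_distrib]
    refine Finset.sum_congr rfl fun p hp => ?_
    rw [D_mul, D_E, D_E, smul_mul_assoc, mul_smul_comm]

/-- Order at most `n`. -/
def L (K : Type*) [Field K] {A : Type*} [Ring A] [Algebra K A] (z : A) (n : ℤ) (a : A) : Prop :=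
  ∀ k : ℕ, n < k → E K z k a = 0

lemma L.mono {z : A} {n m : ℤ} {a : A} (h : L K z n a) (hm : n ≤ m) : L K z m a :=
  fun k hk => h k (by omega)

lemma L.neg {z : A} {n : ℤ} {a : A} (h : L K z n a) (hn : n < 0) : a = 0 := by
  simpa [E_zero] using h 0 (by simpa using hn)

lemma L_zero (z : A) (n : ℤ) : L K z n (0:A) := fun k _ => by simp

lemma L.add {z : A} {n : ℤ} {a b : A} (h : L K z n a) (h2 : L K z n b) : L K z n (a + b) :=
  fun k hk => by rw [map_add, h k hk, h2 k hk, add_zero]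

lemma L.sub {z : A} {n : ℤ} {a b : A} (h : L K z n a) (h2 : L K z n b) : L K z n (a - b) :=
  fun k hk => by rw [map_sub, h k hk, h2 k hk, sub_zero]

lemma L.smul {z : A} {n : ℤ} {a : A} (c : K) (h : L K z n a) : L K z n (c • a) :=
  fun k hk => by rw [map_smul, h k hk, smul_zero]

lemma L.mul [CharZero K] {z : A} {n m : ℤ} {a b : A} (h : L K z n a) (h2 : L K z m b) :
    L K z (n + m) (a * b) := by
  intro k hk
  rw [E_mul]
  refine Finset.sum_eq_zero fun p hp => ?_
  have := Finset.HasAntidiagonal.mem_antidiagonal.1 hp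
  by_cases h1 : n < p.1
  · rw [h _ h1, zero_mul]
  · rw [h2 p.2 (by omega), mul_zero]

lemma L.pred {z : A} {n : ℕ} {a : A} (h : L K z n a) (h2 : E K z n a = 0) :
    L K z ((n : ℤ) - 1) a := by
  intro k hk
  by_cases hkn : k = n
  · rw [hkn, h2]
  · exact h k (by omega)

lemma E_top [CharZero K] {z : A} {n m : ℕ} {a b : A} (h : L K z n a) (h2 : L K z m b) :
    E K z (n + m) (a * b) = E K z n a * E K z m b := by
  rw [E_mul, Finset.sum_eq_single (n, m)]
  · intro p hp hne
    have := Finset.HasAntidiagonal.mem_antidiagonal.1 hp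
    by_cases h1 : n < p.1
    · rw [h _ (by exact_mod_cast h1), zero_mul]
    · by_cases h3 : m < p.2
      · rw [h2 _ (by exact_mod_cast h3), mul_zero]
      · exact absurd (Prod.ext (by simp; omega) (by simp; omega)) hne
  · intro h; simp at h

/-- second symbol, both positive -/
lemma E_sub [CharZero K] {z : A} {n m : ℕ} {a b : A} (h : L K z (n + 1 : ℕ) a)
    (h2 : L K z (m + 1 : ℕ) b) :
    E K z (n + m + 1) (a * b) =
      E K z (n + 1) a * E K z m b + E K z n a * E K z (m + 1) b := by
  rw [E_mul, ← Finset.sum_subset (s₁ := {(n + 1, m), (n, m + 1)})]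
  · rw [Finset.sum_pair]; simp
  · intro p hp; simp at hp; rcases hp with rfl | rfl <;> simp <;> omega
  · intro p hp hne
    have := Finset.HasAntidiagonal.mem_antidiagonal.1 hp
    simp only [Finset.mem_insert, Finset.mem_singleton, Prod.ext_iff, not_or] at hne
    by_cases h1 : n + 1 < p.1
    · rw [h _ (by exact_mod_cast h1), zero_mul]
    · rw [h2 p.2 (by push_cast; omega), mul_zero]

lemma L_of_comm [CharZero K] {z a : A} (h : a * z = z * a) : L K z 0 a := by
  intro k hk
  obtain ⟨k, rfl⟩ : ∃ j, k = j + 1 := ⟨k - 1, by omega⟩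
  have : D K z a = 0 := by rw [D_apply, h, sub_self]
  simp [E, pow_succ, this]

lemma E_D_zero [CharZero K] {z : A} {n : ℕ} {a : A} (h : L K z n a) : D K z (E K z n a) = 0 := by
  rw [D_E, h _ (by omega), smul_zero]

lemma L_one_of [CharZero K] {x y : A} (h : y * x - x * y = 1) : L K x 1 y := by
  intro k hk
  obtain ⟨k, rfl⟩ : ∃ j, k = j + 2 := ⟨k - 2, by omega⟩
  have : D K x y = 1 := by rw [D_apply, h]
  simp [E, pow_succ, this, D_apply x (1:A)]

lemma exists_L_of_adjoin [CharZero K] {x y : A} (h : y * x - x * y = 1) {a : A}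
    (ha : a ∈ Algebra.adjoin K ({x, y} : Set A)) : ∃ n : ℕ, L K x n a := by
  induction ha using Algebra.adjoin_induction with
  | mem a ha =>
    rcases ha with rfl | rfl
    · exact ⟨0, L_of_comm rfl⟩
    · exact ⟨1, L_one_of h⟩
  | algebraMap r => exact ⟨0, L_of_comm (Algebra.commutes r _)⟩
  | add a b _ _ ha hb =>
    obtain ⟨n, hn⟩ := ha
    obtain ⟨m, hm⟩ := hb
    exact ⟨n + m, (hn.mono (by simp)).add (hm.mono (by simp))⟩
  | mul a b _ _ ha hb =>
    obtain ⟨n, hn⟩ := ha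
    obtain ⟨m, hm⟩ := hb
    exact ⟨n + m, by simpa using hn.mul hm⟩

lemma comm_pow {x y : A} (h : y * x - x * y = 1) (i : ℕ) :
    y * x ^ i = x ^ i * y + (i : A) * x ^ (i - 1) := by
  have h' : y * x = x * y + 1 := by rw [← h]; abel
  induction i with
  | zero => simp
  | succ i ih =>
    rw [pow_succ, ← mul_assoc, ih, add_mul, mul_assoc, h']
    rcases i with _ | i
    · simp
    · simp only [Nat.add_sub_cancel, mul_assoc, ← pow_succ]
      push_cast; noncomm_ring

lemma comm_aeval {x y : A} (h : y * x - x * y = 1) (p : K[X]) :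
    y * aeval x p - aeval x p * y = aeval x (derivative p) := by
  induction p using Polynomial.induction_on' with
  | add p q hp hq => simp only [map_add, ← hp, ← hq]; noncomm_ring
  | monomial n a =>
    simp only [aeval_monomial, derivative_monomial]
    rw [← mul_assoc, ← Algebra.commutes, mul_assoc, mul_assoc, comm_pow h]
    simp [mul_add, mul_assoc]

/-- span of monomials of `y`-degree less than `n` -/
def G (K : Type*) [Field K] {A : Type*} [Ring A] [Algebra K A] (x y : A) (n : ℕ) :
    Submodule K A := Submodule.span K {a | ∃ i j : ℕ, j < n ∧ a = x ^ i * y ^ j}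

lemma G_mono {x y : A} {n m : ℕ} (h : n ≤ m) : G K x y n ≤ G K x y m :=
  Submodule.span_mono fun _ ⟨i, j, hj, e⟩ => ⟨i, j, by omega, e⟩

lemma mono_mem_G (x y : A) {n i j : ℕ} (h : j < n) : x ^ i * y ^ j ∈ G K x y n :=
  Submodule.subset_span ⟨i, j, h, rfl⟩

lemma x_mul_G {x y a : A} {n : ℕ} (ha : a ∈ G K x y n) : x * a ∈ G K x y n := by
  unfold G at ha
  induction ha using Submodule.span_induction with
  | mem a ha =>
    obtain ⟨i, j, hj, rfl⟩ := ha
    rw [← mul_assoc, ← pow_succ']; exact mono_mem_G _ _ hj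
  | zero => simp
  | add a b _ _ ha hb => rw [mul_add]; exact add_mem ha hb
  | smul c a _ ha => rw [mul_smul_comm]; exact Submodule.smul_mem _ _ ha

lemma y_mul_G {x y a : A} (h : y * x - x * y = 1) {n : ℕ} (ha : a ∈ G K x y n) :
    y * a ∈ G K x y (n + 1) := by
  unfold G at ha
  induction ha using Submodule.span_induction with
  | mem a ha =>
    obtain ⟨i, j, hj, rfl⟩ := ha
    rw [← mul_assoc, comm_pow h, add_mul, mul_assoc, ← pow_succ', mul_assoc, ← nsmul_eq_mul]
    exact add_mem (mono_mem_G _ _ (by omega)) (nsmul_mem (mono_mem_G _ _ (by omega)) _)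
  | zero => simp
  | add a b _ _ ha hb => rw [mul_add]; exact add_mem ha hb
  | smul c a _ ha => rw [mul_smul_comm]; exact Submodule.smul_mem _ _ ha

lemma adjoin_G {x y : A} (h : y * x - x * y = 1) {a : A}
    (ha : a ∈ Algebra.adjoin K ({x, y} : Set A)) : ∃ n, a ∈ G K x y n := by
  suffices H : ∀ m, ∀ b ∈ G K x y m, ∃ n, a * b ∈ G K x y n by
    simpa using H 1 1 (by simpa using mono_mem_G (K := K) x y (n := 1) (i := 0) (j := 0) (by simp))
  induction ha using Algebra.adjoin_induction with
  | mem a ha =>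
    rcases ha with rfl | rfl
    · exact fun m b hb => ⟨m, x_mul_G hb⟩
    · exact fun m b hb => ⟨m + 1, y_mul_G h hb⟩
  | algebraMap r =>
    exact fun m b hb => ⟨m, by rw [← Algebra.smul_def]; exact Submodule.smul_mem _ _ hb⟩
  | add a b _ _ ha hb =>
    intro m c hc
    obtain ⟨n, hn⟩ := ha m c hc
    obtain ⟨k, hk⟩ := hb m c hc
    exact ⟨n + k, by
      rw [add_mul]; exact add_mem (G_mono (by omega) hn) (G_mono (by omega) hk)⟩
  | mul a b _ _ ha hb =>
    intro m c hc
    obtain ⟨k, hk⟩ := hb m c hc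
    obtain ⟨n, hn⟩ := ha k _ hk
    exact ⟨n, by rwa [mul_assoc]⟩

/-- `ad y` is onto on the subalgebra. -/
lemma surj_ad [CharZero K] {x y : A} (h : y * x - x * y = 1) {a : A}
    (ha : a ∈ Algebra.adjoin K ({x, y} : Set A)) :
    ∃ b ∈ Algebra.adjoin K ({x, y} : Set A), y * b - b * y = a := by
  have hx : x ∈ Algebra.adjoin K ({x, y} : Set A) := Algebra.subset_adjoin (by simp)
  have hy : y ∈ Algebra.adjoin K ({x, y} : Set A) := Algebra.subset_adjoin (by simp)
  obtain ⟨n, hn⟩ := adjoin_G h ha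
  clear ha
  unfold G at hn
  induction hn using Submodule.span_induction with
  | mem a ha =>
    obtain ⟨i, j, hj, rfl⟩ := ha
    have h' : ((i + 1 : ℕ) : K) ≠ 0 := by exact_mod_cast i.succ_ne_zero
    refine ⟨((i + 1 : ℕ) : K)⁻¹ • (x ^ (i + 1) * y ^ j), Subalgebra.smul_mem _ (mul_mem (pow_mem hx _) (pow_mem hy _)) _, ?_⟩
    rw [mul_smul_comm, smul_mul_assoc, ← smul_sub, inv_smul_eq_iff₀ h', ← mul_assoc, comm_pow h,
      add_mul, mul_assoc, mul_assoc (x ^ (i + 1)), ← pow_succ, ← pow_succ', Nat.cast_smul_eq_nsmul]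
    simp [nsmul_eq_mul, mul_assoc]
  | zero => exact ⟨0, zero_mem _, by simp⟩
  | add a b _ _ ha hb =>
    obtain ⟨c, hc, rfl⟩ := ha
    obtain ⟨d, hd, rfl⟩ := hb
    exact ⟨c + d, add_mem hc hd, by noncomm_ring⟩
  | smul r a _ ha =>
    obtain ⟨c, hc, rfl⟩ := ha
    exact ⟨r • c, Subalgebra.smul_mem _ hc _, by rw [mul_smul_comm, smul_mul_assoc, ← smul_sub]⟩

set_option linter.unusedSectionVars false

lemma proportional [CharZero K] {u v : K[X]} (hv : v ≠ 0)
    (h : derivative u * v = u * derivative v) : ∃ c : K, u = C c * v := by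
  refine ⟨u.coeff v.natDegree / v.leadingCoeff, ?_⟩
  have hl : v.leadingCoeff ≠ 0 := leadingCoeff_ne_zero.2 hv
  set c := u.coeff v.natDegree / v.leadingCoeff with hc
  by_contra hne
  set w := u - C c * v with hw
  have hw0 : w ≠ 0 := sub_ne_zero.2 hne
  have hww : derivative w * v = w * derivative v := by
    simp only [hw, derivative_sub, derivative_C_mul, sub_mul, h]; ring
  have hwc : w.coeff v.natDegree = 0 := by
    rw [hw, coeff_sub, coeff_C_mul, coeff_natDegree, hc, div_mul_cancel₀ _ hl, sub_self]
  have key : ∀ p : K[X], (X * derivative p).coeff p.natDegree = p.natDegree * p.leadingCoeff ∧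
      (X * derivative p).natDegree ≤ p.natDegree := by
    intro p
    constructor
    · cases hn : p.natDegree with
      | zero => simp
      | succ n =>
        rw [coeff_X_mul, coeff_derivative, leadingCoeff, hn]; push_cast; ring
    · rcases Nat.eq_zero_or_pos p.natDegree with h0 | h0
      · rw [derivative_of_natDegree_zero h0]; simp
      · refine natDegree_mul_le.trans ?_
        have := natDegree_derivative_lt h0.ne'
        rw [natDegree_X]; omega
  have e1 : (X * derivative w * v).coeff (w.natDegree + v.natDegree) =
      w.natDegree * w.leadingCoeff * v.leadingCoeff := by
    rw [coeff_mul_add_eq_of_natDegree_le (key w).2 le_rfl, (key w).1, coeff_natDegree]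
  have e2 : (w * (X * derivative v)).coeff (w.natDegree + v.natDegree) =
      w.leadingCoeff * (v.natDegree * v.leadingCoeff) := by
    rw [coeff_mul_add_eq_of_natDegree_le le_rfl (key v).2, (key v).1, coeff_natDegree]
  have e3 : X * derivative w * v = w * (X * derivative v) := by
    rw [mul_assoc, hww]; ring
  rw [e3, e2] at e1
  have hlw : w.leadingCoeff ≠ 0 := leadingCoeff_ne_zero.2 hw0
  have : (w.natDegree : K) = v.natDegree := by
    apply mul_right_cancel₀ (mul_ne_zero hlw hl)
    linear_combination -e1
  have : w.natDegree = v.natDegree := by exact_mod_cast this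
  rw [← this] at hwc
  exact hlw hwc

lemma pow_proportional [CharZero K] {f g : K[X]} {n m : ℕ} (hg : g ≠ 0) (hm : m ≠ 0)
    (h : (n : K[X]) * f * derivative g = m * g * derivative f) :
    ∃ c : K, f ^ m = C c * g ^ n := by
  apply proportional (pow_ne_zero _ hg)
  obtain ⟨m, rfl⟩ : ∃ j, m = j + 1 := ⟨m - 1, by omega⟩
  rcases n with _ | n
  · have : derivative f = 0 := by
      have h2 : ((m + 1 : ℕ) : K[X]) ≠ 0 := by exact_mod_cast hm
      rw [Nat.cast_zero, zero_mul, zero_mul] at h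
      exact (mul_eq_zero.1 h.symm).resolve_left (mul_ne_zero h2 hg)
    simp [derivative_pow, this]
  · simp only [derivative_pow, Nat.add_sub_cancel, map_natCast]
    linear_combination (-f ^ m * g ^ n) * h

/-- `A` is a Weyl algebra with generators `X, Y`. -/
structure W (K : Type*) [Field K] {A : Type*} [Ring A] [Algebra K A] (X Y : A) : Prop where
  comm : Y * X - X * Y = 1
  gen : ∀ a, a ∈ Algebra.adjoin K ({X, Y} : Set A)

lemma D_aeval (z : A) (p : K[X]) : D K z (aeval z p) = 0 := by
  have h := (commute_X p).map (aeval z (R := K))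
  rw [aeval_X] at h
  rw [D_apply, h.eq, sub_self]

lemma L_aeval [CharZero K] (z : A) (p : K[X]) : L K z 0 (aeval z p) :=
  L_of_comm (by simpa [D_apply, sub_eq_zero] using D_aeval z p)

lemma aeval_inj [CharZero K] [Nontrivial A] {x y : A} (h : y * x - x * y = 1) (p : K[X])
    (hp : aeval x p = 0) : p = 0 := by
  induction hn : p.natDegree using Nat.strong_induction_on generalizing p with
  | _ n ih =>
    subst hn
    by_cases h0 : p.natDegree = 0
    · rw [eq_C_of_natDegree_eq_zero h0] at hp ⊢
      rw [aeval_C] at hp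
      rw [(map_eq_zero_iff _ (algebraMap K A).injective).1 hp, C_0]
    · have := ih _ (natDegree_derivative_lt h0) (derivative p)
        (by rw [← comm_aeval h, hp]; simp) rfl
      exact absurd (derivative_eq_zero.1 this) h0

lemma aeval_inj' [CharZero K] [Nontrivial A] {x y : A} (h : y * x - x * y = 1) {p q : K[X]}
    (hp : aeval x p = aeval x q) : p = q :=
  sub_eq_zero.1 (aeval_inj h _ (by rw [map_sub, hp, sub_self]))

lemma E_left [CharZero K] {z a b : A} (h : L K z 0 a) (k : ℕ) :
    E K z k (a * b) = a * E K z k b := by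
  rw [E_mul, Finset.sum_eq_single (0, k)]
  · simp [E_zero]
  · intro p hp hne
    have := Finset.HasAntidiagonal.mem_antidiagonal.1 hp
    rw [h p.1, zero_mul]
    by_contra h0
    exact hne (Prod.ext (by simp; omega) (by simp; omega))
  · intro h; simp at h

lemma E_right [CharZero K] {z a b : A} (h : L K z 0 a) (k : ℕ) :
    E K z k (b * a) = E K z k b * a := by
  rw [E_mul, Finset.sum_eq_single (k, 0)]
  · simp [E_zero]
  · intro p hp hne
    have := Finset.HasAntidiagonal.mem_antidiagonal.1 hp
    rw [h p.2, mul_zero]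
    by_contra h0
    exact hne (Prod.ext (by simp; omega) (by simp; omega))
  · intro h; simp at h

lemma L_pow [CharZero K] {z a : A} {n : ℕ} (h : L K z n a) (k : ℕ) :
    L K z (k * n : ℕ) (a ^ k) := by
  induction k with
  | zero => simpa using L_of_comm (by simp)
  | succ k ih => rw [pow_succ]; exact (ih.mul h).mono (by push_cast; linarith)

lemma E_pow [CharZero K] {z a : A} {n : ℕ} (h : L K z n a) (k : ℕ) :
    E K z (k * n) (a ^ k) = (E K z n a) ^ k := by
  induction k with
  | zero => simp [E_zero]
  | succ k ih => rw [pow_succ, add_mul, one_mul, E_top (L_pow h k) h, ih, pow_succ]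

lemma E_Y_pow [CharZero K] {x y : A} (h : y * x - x * y = 1) (n : ℕ) :
    E K x n (y ^ n) = 1 := by
  have := E_pow (n := 1) (L_one_of (K := K) h) n
  rw [mul_one] at this
  rw [this, E_succ, E_zero, D_apply, h]; simp

lemma G_L [CharZero K] {x y a : A} (h : y * x - x * y = 1) {n : ℕ} (ha : a ∈ G K x y n) :
    L K x (n - 1) a := by
  unfold G at ha
  induction ha using Submodule.span_induction with
  | mem a ha =>
    obtain ⟨i, j, hj, rfl⟩ := ha
    have h1 : L K x 0 (x ^ i) := L_of_comm (by rw [← pow_succ, pow_succ'])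
    have h2 := L_pow (n := 1) (L_one_of (K := K) h) j
    exact (h1.mul h2).mono (by push_cast; omega)
  | zero => exact L_zero _ _
  | add a b _ _ ha hb => exact ha.add hb
  | smul c a _ ha => exact ha.smul c

lemma G_split {x y a : A} {n : ℕ} (ha : a ∈ G K x y (n + 1)) :
    ∃ p : K[X], a - aeval x p * y ^ n ∈ G K x y n := by
  unfold G at ha
  induction ha using Submodule.span_induction with
  | mem a ha =>
    obtain ⟨i, j, hj, rfl⟩ := ha
    by_cases hjn : j = n
    · exact ⟨X ^ i, by simp [hjn]⟩
    · exact ⟨0, by simpa using mono_mem_G x y (by omega)⟩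
  | zero => exact ⟨0, by simp⟩
  | add a b _ _ ha hb =>
    obtain ⟨p, hp⟩ := ha
    obtain ⟨q, hq⟩ := hb
    refine ⟨p + q, ?_⟩
    convert add_mem hp hq using 1
    rw [map_add]; noncomm_ring
  | smul c a _ ha =>
    obtain ⟨p, hp⟩ := ha
    refine ⟨c • p, ?_⟩
    convert Submodule.smul_mem _ c hp using 1
    rw [map_smul, smul_sub, smul_mul_assoc]

section
variable [CharZero K] [Nontrivial A] {x y : A}

lemma ker_D (w : W K x y) {a : A} (ha : D K x a = 0) : ∃ p : K[X], a = aeval x p := by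
  obtain ⟨n, hn⟩ := adjoin_G w.comm (w.gen a)
  have hL : L K x 0 a := L_of_comm (by rwa [D_apply, sub_eq_zero] at ha)
  induction n with
  | zero => exact ⟨0, by rw [(G_L w.comm hn).neg (by simp), map_zero]⟩
  | succ n ih =>
    obtain ⟨p, hp⟩ := G_split hn
    rcases n with _ | n
    · exact ⟨p, by simpa [sub_eq_zero] using (G_L w.comm hp).neg (by simp)⟩
    · apply ih
      have h1 := G_L w.comm hp (n + 1) (by push_cast; omega)
      rw [map_sub, hL _ (by omega), E_left (L_aeval x p), E_Y_pow w.comm] at h1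
      simp at h1
      simpa [h1] using hp

lemma symbol (w : W K x y) {n : ℕ} {a : A} (ha : L K x n a) : ∃ p : K[X], E K x n a = aeval x p :=
  ker_D w (E_D_zero ha)

lemma sub_symbol (w : W K x y) {n : ℕ} {a : A} {f : K[X]}
    (hf : E K x (n + 1) a = aeval x f) :
    ∃ p : K[X], E K x n a = ((n + 1 : ℕ) : K) • (aeval x f * y) + aeval x p := by
  obtain ⟨p, hp⟩ := ker_D w (a := E K x n a - ((n + 1 : ℕ) : K) • (aeval x f * y)) (by
    rw [map_sub, D_E, hf, map_smul, D_mul, D_aeval, D_apply x y, w.comm]; simp)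
  exact ⟨p, by rw [← hp]; abel⟩

lemma aeval_comm (x : A) (p q : K[X]) : aeval x p * aeval x q = aeval x q * aeval x p := by
  rw [← map_mul, mul_comm, map_mul]

lemma bracket_aux (w : W K x y) (f g q : K[X]) (m : ℕ) :
    aeval x f * ((m : K) • (aeval x g * y) + aeval x q) -
      ((m : K) • (aeval x g * y) + aeval x q) * aeval x f = - aeval x ((m : K[X]) * g * derivative f) := by
  have h : y * aeval x f = aeval x (derivative f) + aeval x f * y := by
    rw [← comm_aeval w.comm]; abel
  rw [mul_add, add_mul, mul_smul_comm, smul_mul_assoc, mul_assoc (aeval x g) y, h,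
    aeval_comm x q f, mul_add, ← mul_assoc (aeval x g) _ y, aeval_comm x g f]
  simp only [map_mul, map_natCast, Nat.cast_smul_eq_nsmul, nsmul_eq_mul]
  noncomm_ring

lemma bracket (w : W K x y) {n m N : ℕ} (hN : N + 1 = n + m) {a b : A} {f g : K[X]}
    (ha : L K x n a) (hb : L K x m b) (hf : E K x n a = aeval x f) (hg : E K x m b = aeval x g) :
    E K x N (a * b - b * a) = aeval x ((n : K[X]) * f * derivative g - (m : K[X]) * g * derivative f) := by
  rcases n with _ | n <;> rcases m with _ | m
  · omega
  · obtain rfl : N = m := by omega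
    obtain ⟨q, hq⟩ := sub_symbol w hg
    rw [E_zero] at hf
    rw [map_sub, E_left (by simpa using ha), E_right (by simpa using ha), hf, hq, bracket_aux w]
    simp
  · obtain rfl : N = n := by omega
    obtain ⟨q, hq⟩ := sub_symbol w hf
    rw [E_zero] at hg
    rw [map_sub, E_left (a := b) (by simpa using hb), E_right (a := b) (by simpa using hb), hg, hq, ← neg_sub,
      bracket_aux w]
    simp
  · obtain rfl : N = n + m + 1 := by omega
    obtain ⟨p, hp⟩ := sub_symbol w hf
    obtain ⟨q, hq⟩ := sub_symbol w hg
    have e2 := E_sub hb ha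
    rw [add_comm m n] at e2
    rw [map_sub, E_sub ha hb, e2]
    have h1 := bracket_aux w f g q (m + 1)
    have h2 := bracket_aux w g f p (n + 1)
    rw [← hq, ← hf] at h1
    rw [← hp, ← hg] at h2
    rw [map_sub, ← neg_neg (aeval x (((n + 1 : ℕ) : K[X]) * f * derivative g)), ← h2, sub_eq_add_neg _ (aeval x _), ← h1]
    noncomm_ring

lemma L_bracket (w : W K x y) {n m : ℤ} {a b : A} (ha : L K x n a) (hb : L K x m b) :
    L K x (n + m - 1) (a * b - b * a) := by
  by_cases hn : n < 0
  · rw [ha.neg hn]; simpa using L_zero _ _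
  by_cases hm : m < 0
  · rw [hb.neg hm]; simpa using L_zero _ _
  lift n to ℕ using by omega
  lift m to ℕ using by omega
  have h1 : L K x (n + m : ℕ) (a * b - b * a) :=
    ((ha.mul hb).sub ((hb.mul ha).mono (by omega))).mono (by simp)
  refine (h1.pred ?_).mono (by push_cast; exact le_rfl)
  obtain ⟨f, hf⟩ := symbol w ha
  obtain ⟨g, hg⟩ := symbol w hb
  have e2 := E_top hb ha
  rw [add_comm] at e2
  rw [map_sub, E_top ha hb, e2, hf, hg, aeval_comm, sub_self]

lemma exists_order (w : W K x y) {a : A} (ha : a ≠ 0) : ∃ n : ℕ, L K x n a ∧ E K x n a ≠ 0 := by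
  obtain ⟨n, hn⟩ := exists_L_of_adjoin w.comm (w.gen a)
  induction n with
  | zero => exact ⟨0, hn, by rwa [E_zero]⟩
  | succ n ih =>
    by_cases h : E K x (n + 1) a = 0
    · exact ih (by simpa using hn.pred h)
    · exact ⟨_, hn, h⟩

lemma d_pow (w : W K x y) {u v : A} {n t : ℕ} {f h : K[X]} (hu : L K x n u)
    (hd : L K x t (v * u - u * v)) (hf : E K x n u = aeval x f)
    (hh : E K x t (v * u - u * v) = aeval x h) (k : ℕ) :
    L K x (k * n + t : ℕ) (v * u ^ (k + 1) - u ^ (k + 1) * v) ∧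
    E K x (k * n + t) (v * u ^ (k + 1) - u ^ (k + 1) * v) =
      aeval x (((k + 1 : ℕ) : K[X]) * f ^ k * h) := by
  induction k with
  | zero => simpa [hh] using hd
  | succ k ih =>
    obtain ⟨h1, h2⟩ := ih
    have e : v * u ^ (k + 1 + 1) - u ^ (k + 1 + 1) * v =
        (v * u ^ (k + 1) - u ^ (k + 1) * v) * u + u ^ (k + 1) * (v * u - u * v) := by
      rw [pow_succ u (k + 1)]; noncomm_ring
    have e1 : (k + 1) * n + t = (k * n + t) + n := by ring
    have h3 := E_top h1 hu
    have h4 := E_top (L_pow hu (k + 1)) hd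
    rw [e]
    refine ⟨((h1.mul hu).mono (by push_cast; linarith)).add
      (((L_pow hu (k + 1)).mul hd).mono (by push_cast; linarith)), ?_⟩
    rw [map_add, h4, e1, h3, h2, hf, hh, E_pow hu, hf, ← map_pow, ← map_mul, ← map_mul, ← map_add]
    congr 1
    push_cast; ring

lemma descent (w : W K x y) {z v : A} {m : ℕ} {g : K[X]} {ε : K} (hm : m ≠ 0) (hz : L K x m z)
    (hg : E K x m z = aeval x g) (hg0 : g ≠ 0) (hv : v * z - z * v = algebraMap K A ε)
    {s : ℤ} (hs : ε = 0 ∨ -(m : ℤ) < s)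
    (P : ∀ u, u * z = z * u → ∀ n : ℕ, L K x n u → L K x (n + s) (v * u - u * v)) :
    ∀ u, u * z = z * u → ∀ n : ℕ, L K x n u → L K x (n + (s - 1)) (v * u - u * v) := by
  intro u hu n hn
  obtain ⟨f, hf⟩ := symbol w hn
  by_cases hE : E K x n u = 0
  · have h1 := hn.pred hE
    rcases n with _ | n
    · rw [h1.neg (by simp)]; simpa using L_zero _ _
    · refine (P u hu n (by simpa using h1)).mono (by push_cast; linarith)
  have hf0 : f ≠ 0 := by rintro rfl; exact hE (by simpa using hf)
  have hns := P u hu n hn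
  by_cases htn : (n : ℤ) + s < 0
  · rw [hns.neg htn]; exact L_zero _ _
  obtain ⟨t, ht⟩ : ∃ t : ℕ, (n : ℤ) + s = t := ⟨((n : ℤ) + s).toNat, by omega⟩
  rw [ht] at hns
  rw [show (n : ℤ) + (s - 1) = t - 1 by omega]
  apply hns.pred
  obtain ⟨h, hh⟩ := symbol w hns
  rw [hh]
  -- proportionality
  obtain ⟨c, hc⟩ : ∃ c : K, f ^ m = C c * g ^ n := by
    apply pow_proportional hg0 hm
    have h1 := bracket w (N := n + m - 1) (by omega) hn hz hf hg
    rw [hu, sub_self, map_zero] at h1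
    exact sub_eq_zero.1 (aeval_inj w.comm _ h1.symm)
  set q := u ^ m - c • z ^ n with hq
  have hqz : q * z = z * q := by
    have h1 : Commute u z := hu
    exact ((h1.pow_left m).sub_left (((Commute.refl z).pow_left n).smul_left c)).eq
  have hqL : L K x (m * n : ℕ) q :=
    (L_pow hn m).sub (((L_pow hz n).smul c).mono (by push_cast; linarith))
  have hqE : E K x (m * n) q = 0 := by
    rw [hq, map_sub, map_smul, E_pow hn, mul_comm m n, E_pow hz, hf, hg, ← map_pow, ← map_pow,
      hc, map_mul, aeval_C, ← Algebra.smul_def, sub_self]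
  have hq1 := hqL.pred hqE
  have hdq : L K x (m * n - 1 + s) (v * q - q * v) := by
    by_cases h0 : m * n = 0
    · rw [h0] at hq1
      rw [hq1.neg (by simp)]; simpa using L_zero _ _
    · refine (P q hqz (m * n - 1) (hq1.mono (by omega))).mono ?_
      rw [Nat.cast_sub (by omega)]; push_cast; exact le_rfl
  have hdz : L K x (m * n - 1 + s) (v * z ^ n - z ^ n * v) := by
    have e : v * z ^ n - z ^ n * v = (ε * n) • z ^ (n - 1) := by
      clear_value q
      clear hdq hq1 hqE hqL hqz hq hc hh hns hf hn hE ht htn P hu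
      have hv' : v * z = z * v + algebraMap K A ε := by rw [← hv]; abel
      induction n with
      | zero => simp
      | succ n ih =>
        have e2 : v * z ^ (n + 1) - z ^ (n + 1) * v =
            (v * z ^ n - z ^ n * v) * z + z ^ n * (v * z - z * v) := by
          rw [pow_succ]; noncomm_ring
        rw [e2, ih, hv, ← Algebra.commutes, ← Algebra.smul_def, smul_mul_assoc, ← pow_succ]
        rcases n with _ | n
        · simp
        · simp only [Nat.add_sub_cancel]
          rw [← add_smul]; congr 1; push_cast; ring
    rw [e]
    rcases hs with rfl | hs
    · simpa using L_zero _ _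
    rcases n with _ | n
    · simpa using L_zero _ _
    · refine ((L_pow hz n).smul _).mono ?_
      push_cast
      linarith
  have hdu : L K x (m * n - 1 + s) (v * u ^ m - u ^ m * v) := by
    have e : v * u ^ m - u ^ m * v = (v * q - q * v) + c • (v * z ^ n - z ^ n * v) := by
      rw [hq, mul_sub, sub_mul, smul_sub, mul_smul_comm, smul_mul_assoc]; abel
    rw [e]
    exact hdq.add (hdz.smul c)
  obtain ⟨k, rfl⟩ : ∃ k, m = k + 1 := ⟨m - 1, by omega⟩
  have h5 := (d_pow w hn hns hf hh k).2
  rw [hdu _ (by push_cast; linarith)] at h5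
  have h6 := aeval_inj w.comm _ h5.symm
  have h7 : ((k + 1 : ℕ) : K[X]) ≠ 0 := by exact_mod_cast hm
  rw [(mul_eq_zero.1 h6).resolve_left (mul_ne_zero h7 (pow_ne_zero _ hf0)), map_zero]

lemma base (w : W K x y) (z v : A) : ∃ s : ℕ, 
    ∀ u, u * z = z * u → ∀ n : ℕ, L K x n u → L K x (n + s) (v * u - u * v) := by
  obtain ⟨k, hk⟩ := exists_L_of_adjoin w.comm (w.gen v)
  exact ⟨k, fun u _ n hn => (L_bracket w hk hn).mono (by linarith)⟩

lemma descent_zero (w : W K x y) {z v : A} {m : ℕ} {g : K[X]} (hm : m ≠ 0) (hz : L K x m z)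
    (hg : E K x m z = aeval x g) (hg0 : g ≠ 0) (hv : v * z - z * v = 0)
    (u : A) (hu : u * z = z * u) : v * u - u * v = 0 := by
  obtain ⟨s, hs⟩ := base w z v
  have : ∀ j : ℕ, ∀ u, u * z = z * u → ∀ n : ℕ, L K x n u →
      L K x (n + (s - j : ℤ)) (v * u - u * v) := by
    intro j
    induction j with
    | zero => simpa using hs
    | succ j ih =>
      have := descent w (ε := 0) hm hz hg hg0 (by simpa using hv) (Or.inl rfl) ih
      intro u hu n hn
      exact (this u hu n hn).mono (by push_cast; linarith)
  obtain ⟨n, hn⟩ := exists_L_of_adjoin w.comm (w.gen u)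
  exact (this (n + s + 1) u hu n hn).neg (by push_cast; linarith)

lemma descent_one (w : W K x y) {z v : A} {m : ℕ} {g : K[X]} (hm : m ≠ 0) (hz : L K x m z)
    (hg : E K x m z = aeval x g) (hg0 : g ≠ 0) (hv : v * z - z * v = 1)
    (u : A) (hu : u * z = z * u) (n : ℕ) (hn : L K x n u) :
    L K x (n - m) (v * u - u * v) := by
  obtain ⟨s, hs⟩ := base w z v
  have : ∀ j : ℕ, j ≤ s + m → ∀ u, u * z = z * u → ∀ n : ℕ, L K x n u →
      L K x (n + (s - j : ℤ)) (v * u - u * v) := by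
    intro j
    induction j with
    | zero => simpa using hs
    | succ j ih =>
      intro hj
      have := descent w (ε := 1) hm hz hg hg0 (by simpa using hv) (Or.inr (by omega)) (ih (by omega))
      intro u hu n hn
      exact (this u hu n hn).mono (by push_cast; linarith)
  exact (this (s + m) le_rfl u hu n hn).mono (by push_cast; linarith)

lemma cent_poly (w : W K x y) {p : K[X]} (hp : derivative p ≠ 0) {u : A}
    (hu : u * aeval x p = aeval x p * u) : ∃ q : K[X], u = aeval x q := by
  by_cases hu0 : u = 0
  · exact ⟨0, by simp [hu0]⟩
  obtain ⟨n, hn, hE⟩ := exists_order w hu0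
  obtain ⟨f, hf⟩ := symbol w hn
  rcases n with _ | n
  · exact ⟨f, by rw [← hf, E_zero]⟩
  exfalso
  have h1 := bracket w (N := n) (m := 0) (g := p) (by omega) hn (L_aeval x p) hf (E_zero _ _)
  rw [hu, sub_self, map_zero] at h1
  have h2 := aeval_inj w.comm _ h1.symm
  have h7 : ((n + 1 : ℕ) : K[X]) ≠ 0 := by exact_mod_cast n.succ_ne_zero
  rw [Nat.cast_zero, zero_mul, zero_mul, sub_zero] at h2
  rcases mul_eq_zero.1 h2 with h3 | h3
  · rcases mul_eq_zero.1 h3 with h3 | h3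
    · exact h7 h3
    · exact hE (by rw [hf, h3, map_zero])
  · exact hp h3

lemma cent_both (w : W K x y) {a b : A} (hab : b * a - a * b = 1) {c : A} (ha : c * a = a * c)
    (hb : c * b = b * c) : ∃ r : K, c = algebraMap K A r := by
  by_cases hc : c = 0
  · exact ⟨0, by simp [hc]⟩
  obtain ⟨m, hm, hE⟩ := exists_order w hc
  obtain ⟨g, hg⟩ := symbol w hm
  have hg0 : g ≠ 0 := by rintro rfl; exact hE (by simpa using hg)
  by_cases hm0 : m = 0
  · subst hm0
    rw [E_zero] at hg
    by_cases hd : derivative g = 0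
    · refine ⟨g.coeff 0, ?_⟩
      rw [hg, eq_C_of_natDegree_eq_zero (derivative_eq_zero.1 hd)]; simp
    · obtain ⟨p, rfl⟩ := cent_poly w hd (u := a) (by rw [← hg, ha])
      obtain ⟨q, rfl⟩ := cent_poly w hd (u := b) (by rw [← hg, hb])
      rw [aeval_comm, sub_self] at hab
      exact absurd hab zero_ne_one
  · have := descent_zero w hm0 hm hg hg0 (v := b) (by rw [hb, sub_self]) a ha.symm
    rw [hab] at this
    exact absurd this one_ne_zero

lemma exists_antideriv (q : K[X]) : ∃ r : K[X], derivative r = q := by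
  induction q using Polynomial.induction_on' with
  | add p q hp hq =>
    obtain ⟨a, rfl⟩ := hp
    obtain ⟨b, rfl⟩ := hq
    exact ⟨a + b, by simp⟩
  | monomial n a =>
    refine ⟨monomial (n + 1) (a / (n + 1 : ℕ)), ?_⟩
    have h' : ((n + 1 : ℕ) : K) ≠ 0 := by exact_mod_cast n.succ_ne_zero
    rw [derivative_monomial, div_mul_cancel₀ _ h']; simp

lemma cent_one (w : W K x y) {a b : A} (hab : b * a - a * b = 1) {c : A} (hc : c * a = a * c) :
    c ∈ Algebra.adjoin K ({a, b} : Set A) := by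
  have haM : a ∈ Algebra.adjoin K ({a, b} : Set A) := Algebra.subset_adjoin (by simp)
  have ha0 : a ≠ 0 := by rintro rfl; simp at hab
  obtain ⟨m, hm, hE⟩ := exists_order w ha0
  obtain ⟨g, hg⟩ := symbol w hm
  have hg0 : g ≠ 0 := by rintro rfl; exact hE (by simpa using hg)
  by_cases hm0 : m = 0
  · subst hm0
    rw [E_zero] at hg
    have hd : derivative g ≠ 0 := by
      intro hd
      rw [hg, eq_C_of_natDegree_eq_zero (derivative_eq_zero.1 hd), aeval_C, Algebra.commutes,
        sub_self] at hab
      exact zero_ne_one hab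
    have hb0 : b ≠ 0 := by rintro rfl; simp at hab
    obtain ⟨k, hk, hkE⟩ := exists_order w hb0
    obtain ⟨f, hf⟩ := symbol w hk
    have hf0 : f ≠ 0 := by rintro rfl; exact hkE (by simpa using hf)
    have hk0 : k ≠ 0 := by
      rintro rfl
      rw [E_zero] at hf
      rw [hf, hg, aeval_comm, sub_self] at hab
      exact zero_ne_one hab
    obtain ⟨k, rfl⟩ : ∃ j, k = j + 1 := ⟨k - 1, by omega⟩
    have h1 := bracket w (N := k) (m := 0) (g := g) (by omega) hk hm hf (by rw [E_zero, hg])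
    rw [hab, Nat.cast_zero, zero_mul, zero_mul, sub_zero] at h1
    have h7 : ((k + 1 : ℕ) : K[X]) ≠ 0 := by exact_mod_cast k.succ_ne_zero
    rcases k with _ | k
    · rw [E_zero, ← map_one (aeval x (R := K))] at h1
      have h2 := aeval_inj' w.comm h1
      have h3 : IsUnit (derivative g) := IsUnit.of_mul_eq_one_right _ h2.symm
      have h4 := natDegree_eq_zero_of_isUnit h3
      obtain ⟨e, he⟩ := cent_poly w hd (u := c) (by rw [← hg, hc])
      have hx : x ∈ Algebra.adjoin K ({a, b} : Set A) := by
        have h5 : g.natDegree ≤ 1 := by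
          by_contra h6
          rw [natDegree_derivative] at h4
          omega
        obtain ⟨r, t, rfl⟩ := exists_eq_X_add_C_of_natDegree_le_one h5
        have hr : r ≠ 0 := by rintro rfl; simp at hd
        have : x = r⁻¹ • (a - algebraMap K A t) := by
          rw [hg]; simp [← Algebra.smul_def, smul_smul, hr]
        rw [this]
        exact Subalgebra.smul_mem _ (sub_mem haM (Subalgebra.algebraMap_mem _ _)) _
      rw [he]
      exact aeval_mem_adjoin_singleton K x |> fun h => (Algebra.adjoin_le (by simpa using hx)) h
    · rw [L_of_comm (z := x) (a := (1 : A)) (by simp) (k + 1) (by omega)] at h1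
      exact absurd (aeval_inj w.comm _ h1.symm) (mul_ne_zero (mul_ne_zero h7 hf0) hd)
  · obtain ⟨n, hn⟩ := exists_L_of_adjoin w.comm (w.gen c)
    suffices ∃ p : K[X], c = aeval a p by
      obtain ⟨p, rfl⟩ := this
      exact (Algebra.adjoin_mono (by simp)) (aeval_mem_adjoin_singleton K a)
    induction n using Nat.strong_induction_on generalizing c with
    | _ n ih =>
      have h1 := descent_one w hm0 hm hg hg0 hab c hc n hn
      have h2 : (b * c - c * b) * a = a * (b * c - c * b) := by
        have hba : b * a = a * b + 1 := by rw [← hab]; abel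
        have : (b * c - c * b) * a - a * (b * c - c * b) = 0 := by
          have e : (b * c - c * b) * a - a * (b * c - c * b) =
            b * (c * a - a * c) - (c * a - a * c) * b + ((b * a - a * b) * c - c * (b * a - a * b)) := by
            noncomm_ring
          rw [e, hab, hc]; simp
        exact sub_eq_zero.1 this
      have h3 : ∃ p : K[X], b * c - c * b = aeval a p := by
        by_cases hnm : (n : ℤ) - m < 0
        · exact ⟨0, by rw [h1.neg hnm, map_zero]⟩
        · exact ih (n - m) (by omega) h2 (h1.mono (by omega))
      obtain ⟨p, hp⟩ := h3
      obtain ⟨r, rfl⟩ := exists_antideriv p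
      have h4 := D_aeval (K := K) a r
      rw [D_apply, sub_eq_zero] at h4
      obtain ⟨e, he⟩ := cent_both w hab (c := c - aeval a r)
        (by rw [sub_mul, mul_sub, hc, h4])
        (by
          rw [← comm_aeval hab] at hp
          rw [sub_mul, mul_sub, ← sub_eq_zero]
          rw [← sub_eq_zero] at hp
          rw [← neg_eq_zero, ← hp]; abel)
      exact ⟨r + C e, by rw [map_add, aeval_C, ← he]; abel⟩

lemma adjoin_swap (a b : A) :
    Algebra.adjoin K ({b, -a} : Set A) = Algebra.adjoin K ({a, b} : Set A) := by
  apply le_antisymm <;> refine Algebra.adjoin_le ?_ <;> rintro c (rfl | rfl)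
  · exact Algebra.subset_adjoin (by simp)
  · exact neg_mem (Algebra.subset_adjoin (by simp))
  · rw [← neg_neg c]; exact neg_mem (Algebra.subset_adjoin (by simp))
  · exact Algebra.subset_adjoin (by simp)

lemma swap_comm {a b : A} (h : b * a - a * b = 1) : (-a) * b - b * (-a) = 1 := by
  rw [← h]; noncomm_ring

lemma surj_D {a b : A} (hab : b * a - a * b = 1) {c : A}
    (hc : c ∈ Algebra.adjoin K ({a, b} : Set A)) :
    ∃ e ∈ Algebra.adjoin K ({a, b} : Set A), D K a e = c := by
  rw [← adjoin_swap] at hc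
  obtain ⟨e, he, h⟩ := surj_ad (swap_comm hab) hc
  rw [adjoin_swap] at he
  exact ⟨e, he, by rw [D_apply, ← h]; noncomm_ring⟩

/-- `N(ad a)` is contained in the subalgebra. -/
lemma nil_mem (w : W K x y) {a b : A} (hab : b * a - a * b = 1) (n : ℕ) {c : A}
    (hc : ((D K a) ^ n) c ∈ Algebra.adjoin K ({a, b} : Set A)) :
    c ∈ Algebra.adjoin K ({a, b} : Set A) := by
  induction n with
  | zero => simpa using hc
  | succ n ih =>
    apply ih
    rw [pow_succ', Module.End.mul_apply] at hc
    obtain ⟨e, he, h⟩ := surj_D hab hc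
    have : ((D K a) ^ n) c - e ∈ Algebra.adjoin K ({a, b} : Set A) := by
      apply cent_one w hab
      rw [← sub_eq_zero, ← D_apply (K := K), map_sub, h, sub_self]
    simpa using add_mem this he

lemma nil_mem' (w : W K x y) {a b : A} (hab : b * a - a * b = 1) (n : ℕ) {c : A}
    (hc : ((D K b) ^ n) c ∈ Algebra.adjoin K ({a, b} : Set A)) :
    c ∈ Algebra.adjoin K ({a, b} : Set A) := by
  rw [← adjoin_swap] at hc ⊢
  exact nil_mem w (swap_comm hab) n hc

lemma main (w : W K x y) {a b : A} (hab : b * a - a * b = 1) :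
    {c : A | ∃ n : ℕ, 1 ≤ n ∧
        (fun c => a * (b * c - c * b) - (b * c - c * b) * a)^[n] c = 0}
      = (Algebra.adjoin K ({a, b} : Set A) : Set A) := by
  have hcomm : Commute (D K a) (D K b) := by
    have hba : b * a = a * b + 1 := by rw [← hab]; abel
    refine LinearMap.ext fun c => ?_
    simp only [Module.End.mul_apply, D_apply]
    have e : (c * b - b * c) * a - a * (c * b - b * c) - ((c * a - a * c) * b - b * (c * a - a * c))
      = c * (b * a - a * b) - (b * a - a * b) * c := by noncomm_ring
    rw [← sub_eq_zero, e, hab]; simp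
  have hfun : (fun c => a * (b * c - c * b) - (b * c - c * b) * a) = ⇑(D K a * D K b) := by
    funext c
    simp only [Module.End.mul_apply, D_apply]; noncomm_ring
  ext c
  simp only [Set.mem_ofPred_eq, SetLike.mem_coe, hfun, ← Module.End.pow_apply, hcomm.mul_pow,
    Module.End.mul_apply]
  constructor
  · rintro ⟨n, -, hn⟩
    exact nil_mem' w hab n (nil_mem w hab n (by rw [hn]; exact zero_mem _))
  · intro hc
    rw [← adjoin_swap] at hc
    obtain ⟨n, hn⟩ := exists_L_of_adjoin (swap_comm hab) hc
    refine ⟨n + 1, by omega, ?_⟩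
    have h1 := hn (n + 1) (by push_cast; omega)
    have h2 : (((n + 1).factorial : ℕ) : K) ≠ 0 := by exact_mod_cast (n + 1).factorial_ne_zero
    rw [E, LinearMap.smul_apply, smul_eq_zero_iff_right (inv_ne_zero h2)] at h1
    rw [h1, map_zero]

end

lemma weyl_W (K : Type*) [Field K] :
    W K (A := WeylAlgebra K) (RingQuot.mkAlgHom K (weylRel K) (FreeAlgebra.ι K 0))
      (RingQuot.mkAlgHom K (weylRel K) (FreeAlgebra.ι K 1)) := by
  constructor
  · have := RingQuot.mkAlgHom_rel K (s := weylRel K) ⟨rfl, rfl⟩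
    rw [map_mul, map_add, map_mul, map_one] at this
    rw [this]; abel
  · intro a
    obtain ⟨b, rfl⟩ := RingQuot.mkAlgHom_surjective K (weylRel K) a
    induction b using FreeAlgebra.induction with
    | grade0 r => rw [AlgHom.commutes]; exact Subalgebra.algebraMap_mem _ _
    | grade1 i => fin_cases i <;> exact Algebra.subset_adjoin (by simp)
    | mul a b ha hb => rw [map_mul]; exact mul_mem ha hb
    | add a b ha hb => rw [map_add]; exact add_mem ha hb

lemma weyl_nontrivial (K : Type*) [Field K] : Nontrivial (WeylAlgebra K) := by
  let φ : FreeAlgebra K (Fin 2) →ₐ[K] Module.End K K[X] :=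
    FreeAlgebra.lift K ![LinearMap.mulLeft K (X : K[X]), derivative]
  have hφ : ∀ ⦃a b⦄, weylRel K a b → φ a = φ b := by
    rintro _ _ ⟨rfl, rfl⟩
    refine LinearMap.ext fun p => ?_
    simp [φ, FreeAlgebra.lift_ι_apply]
    ring
  exact (RingQuot.liftAlgHom K ⟨φ, hφ⟩).toRingHom.domain_nontrivial

end WeylAux

/-- **Proposition 2.8.(1).** If `[y,x] = 1` for elements `x, y` of the Weyl algebra `A₁`
over a field `K` of characteristic zero, and `δ := ad(x) ∘ ad(y)` (so
`δ(a) = [x, [y, a]]`), then `N(δ, A₁) := {a ∈ A₁ | δⁿ(a) = 0 for some n ≥ 1}` equals the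
subalgebra `A₁' = K⟨x,y⟩` generated by `x` and `y`. -/
theorem nil_of_comp_eq_adjoin (K : Type*) [Field K] [CharZero K]
    (x y : WeylAlgebra K) (hxy : y * x - x * y = 1) :
    {a : WeylAlgebra K | ∃ n : ℕ, 1 ≤ n ∧
        (fun c => x * (y * c - c * y) - (y * c - c * y) * x)^[n] a = 0}
      = (Algebra.adjoin K ({x, y} : Set (WeylAlgebra K)) : Set (WeylAlgebra K)) := by
  haveI := WeylAux.weyl_nontrivial K
  exact WeylAux.main (WeylAux.weyl_W K) hxy
end
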